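/- arXiv:1512.07289 — 4 statements merged into one kernel-verified Lean document; each statement's English description precedes it below -/
import Mathlib

section
/- Let K and L be origin-symmetric convex bodies in the Euclidean plane R^2, each containing the origin in its interior, such that S_K(t) ≤ S_L(t) for all t ≥ 0. Then the area of K is at most the area of L, i.e. |K| ≤ |L|. -/
open MeasureTheory Metric Set
open scoped RealInnerProductSpace ENNReal NNReal

noncomputable section

/-- Euclidean space `ℝ^n`. -/
abbrev Euc (n : ℕ) := EuclideanSpace ℝ (Fin n)

/-- A convex body: a compact convex set with nonempty interior. -/
def IsConvexBody {n : ℕ} (K : Set (Euc n)) : Prop :=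
  Convex ℝ K ∧ IsCompact K ∧ (interior K).Nonempty

/-- The Haar (rotation invariant) probability measure of a set of directions on the
unit sphere `S^{n-1}`, realized as normalized `(n-1)`-dimensional Hausdorff measure. -/
def sphHaar (n : ℕ) (A : Set (Euc n)) : ℝ≥0∞ :=
  μH[(n : ℝ) - 1] (A ∩ sphere (0 : Euc n) 1) / μH[(n : ℝ) - 1] (sphere (0 : Euc n) 1)

/-- `|K ∩ θ^⊥|`: the `(n-1)`-dimensional Hausdorff measure of the central section of `K`
perpendicular to `θ`. -/
def sectionVol (n : ℕ) (K : Set (Euc n)) (θ : Euc n) : ℝ≥0∞ :=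
  μH[(n : ℝ) - 1] (K ∩ {x : Euc n | ⟪x, θ⟫ = 0})

/-- `S_K(t)`: distribution function of the areas of central hyperplane sections. -/
def Sdist (n : ℕ) (K : Set (Euc n)) (t : ℝ) : ℝ≥0∞ :=
  sphHaar n {θ : Euc n | ENNReal.ofReal t ≤ sectionVol n K θ}

/-- `|K | θ^⊥|`: the `(n-1)`-dimensional Hausdorff measure of the orthogonal projection
of `K` onto the hyperplane `θ^⊥` (for a unit vector `θ`). -/
def projVol (n : ℕ) (K : Set (Euc n)) (θ : Euc n) : ℝ≥0∞ :=
  μH[(n : ℝ) - 1] ((fun x => x - ⟪x, θ⟫ • θ) '' K)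

/-- `Π_K(t)`: distribution function of the volumes of hyperplane projections. -/
def PiDist (n : ℕ) (K : Set (Euc n)) (t : ℝ) : ℝ≥0∞ :=
  sphHaar n {θ : Euc n | ENNReal.ofReal t ≤ projVol n K θ}

/-- The radial function `ρ_K(θ) = max {a ≥ 0 : a • θ ∈ K}`. -/
def radial {n : ℕ} (K : Set (Euc n)) (θ : Euc n) : ℝ :=
  sSup {a : ℝ | 0 ≤ a ∧ a • θ ∈ K}

/-- The support function `h_K(θ) = sup_{y ∈ K} ⟨θ, y⟩`. -/
def suppFn {n : ℕ} (K : Set (Euc n)) (θ : Euc n) : ℝ :=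
  sSup ((fun y => ⟪θ, y⟫) '' K)

/-- The polar body `K° = {x : ⟨x, y⟩ ≤ 1 for all y ∈ K}`. -/
def polarBody {n : ℕ} (K : Set (Euc n)) : Set (Euc n) :=
  {x | ∀ y ∈ K, ⟪x, y⟫ ≤ 1}

/-- The standard isometric identification of the complex plane with `ℝ²`. -/
def complexIso : ℂ ≃ₗᵢ[ℝ] Euc 2 := Complex.orthonormalBasisOneI.repr

local instance circleMeasurableSpace : MeasurableSpace Circle := borel Circle

local instance circleBorelSpace : BorelSpace Circle := ⟨rfl⟩

theorem circle_dist_eq (a b : Circle) : dist a b = dist (a : ℂ) b := rfl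

theorem isometry_circle_coe : Isometry (fun w : Circle => (w : ℂ)) :=
  Isometry.of_dist_eq fun a b => (circle_dist_eq a b).symm

theorem isometry_circle_mul_left (w : Circle) : Isometry (fun u : Circle => w * u) := by
  refine Isometry.of_dist_eq fun a b => ?_
  rw [circle_dist_eq, circle_dist_eq, dist_eq_norm, dist_eq_norm,
    Circle.coe_mul, Circle.coe_mul, ← mul_sub, norm_mul, Circle.norm_coe, one_mul]

theorem hausdorffMeasure_circle_preimage_mul_left (w : Circle) (s : Set Circle) :
    μH[1] ((fun u : Circle => w * u) ⁻¹' s) = μH[1] s := by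
  rw [(isometry_circle_mul_left w).hausdorffMeasure_preimage (Or.inl zero_le_one),
    (mul_left_surjective w).range_eq, inter_univ]

theorem hausdorffMeasure_circle_preimage_inv (s : Set Circle) :
    μH[1] ((fun u : Circle => u⁻¹) ⁻¹' s) = μH[1] s := by
  have hi : Isometry (fun u : Circle => u⁻¹) := by
    refine Isometry.of_dist_eq fun a b => ?_
    rw [circle_dist_eq, circle_dist_eq, Circle.coe_inv_eq_conj,
      Circle.coe_inv_eq_conj, Complex.dist_conj_conj]
  rw [hi.hausdorffMeasure_preimage (Or.inl zero_le_one), inv_surjective.range_eq, inter_univ]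

theorem hausdorffMeasure_circle_univ_lt_top : μH[1] (univ : Set Circle) < ∞ := by
  have hl : LipschitzWith 1 (fun t : ℝ => Circle.exp t) := by
    refine LipschitzWith.of_dist_le_mul fun a b => ?_
    rw [circle_dist_eq, NNReal.coe_one, one_mul]
    have hd : ∀ x : ℝ, HasDerivAt (fun t : ℝ => Complex.exp (t * Complex.I))
        (Complex.exp (x * Complex.I) * (1 * Complex.I)) x := fun x =>
      ((Complex.ofRealCLM.hasDerivAt (x := x)).mul_const Complex.I).cexp
    have := Convex.norm_image_sub_le_of_norm_hasDerivWithin_le (C := 1) (s := univ) (x := b) (y := a)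
      (fun x _ => (hd x).hasDerivWithinAt) (fun x _ => by
        rw [norm_mul, Complex.norm_exp_ofReal_mul_I]; simp) convex_univ trivial trivial
    simpa [dist_eq_norm, Circle.coe_exp] using this
  have hs : (univ : Set Circle) ⊆ (fun t : ℝ => Circle.exp t) '' Icc (-Real.pi) Real.pi := by
    intro z _
    exact ⟨Complex.arg z, ⟨(Complex.neg_pi_lt_arg _).le, Complex.arg_le_pi _⟩, Circle.exp_arg z⟩
  refine (measure_mono hs).trans_lt ((hl.hausdorffMeasure_image_le zero_le_one _).trans_lt ?_)
  rw [hausdorffMeasure_real]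
  simp [Real.volume_Icc]

theorem hausdorffMeasure_circle_univ_pos : 0 < μH[1] (univ : Set Circle) := by
  have hl : LipschitzWith 1 (fun w : Circle => (w : ℂ).re) := by
    refine LipschitzWith.of_dist_le_mul fun a b => ?_
    rw [circle_dist_eq, NNReal.coe_one, one_mul, Real.dist_eq, dist_eq_norm,
      ← Complex.sub_re]
    exact Complex.abs_re_le_norm _
  have hs : Icc (-1 : ℝ) 1 ⊆ (fun w : Circle => (w : ℂ).re) '' univ := by
    intro x hx
    refine ⟨Circle.exp (Real.arccos x), trivial, ?_⟩
    simp only [Circle.coe_exp, Complex.exp_ofReal_mul_I_re]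
    exact Real.cos_arccos hx.1 hx.2
  have h := (measure_mono (μ := μH[1]) hs).trans (hl.hausdorffMeasure_image_le zero_le_one _)
  rw [hausdorffMeasure_real, Real.volume_Icc] at h
  simp only [ENNReal.coe_one, ENNReal.one_rpow, one_mul] at h
  refine lt_of_lt_of_le ?_ h
  norm_num

instance isFiniteMeasure_hausdorffMeasure_circle :
    IsFiniteMeasure (μH[1] : Measure Circle) := ⟨hausdorffMeasure_circle_univ_lt_top⟩

/-- Averaging over rotations: the area of a closed plane set, weighted by the length of the circle,
is the integral of the length of its set of directions at distance `‖z‖`. -/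
theorem hausdorffMeasure_circle_mul_volume {A : Set ℂ} (hA : IsClosed A) :
    μH[1] (univ : Set Circle) * volume A =
      ∫⁻ z : ℂ, μH[1] {w : Circle | ((‖z‖ : ℝ) : ℂ) * w ∈ A} := by
  have hrot : ∀ w : Circle, volume {z : ℂ | (w : ℂ) * z ∈ A} = volume A := fun w => by
    have := (rotation w).measurePreserving.measure_preimage hA.measurableSet.nullMeasurableSet
    simpa only [preimage, rotation_apply] using this
  have hset : MeasurableSet {p : Circle × ℂ | (p.1 : ℂ) * p.2 ∈ A} :=
    (hA.preimage (by fun_prop : Continuous fun p : Circle × ℂ => (p.1 : ℂ) * p.2)).measurableSet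
  have h1 := Measure.prod_apply (μ := (μH[1] : Measure Circle)) (ν := (volume : Measure ℂ)) hset
  have h2 := Measure.prod_apply_symm (μ := (μH[1] : Measure Circle)) (ν := (volume : Measure ℂ))
    hset
  simp only [preimage_ofPred_eq, hrot, lintegral_const] at h1 h2
  rw [mul_comm, ← h1, h2]
  refine lintegral_congr fun z => ?_
  obtain ⟨v, hv⟩ : ∃ v : Circle, ((‖z‖ : ℝ) : ℂ) * v = z :=
    ⟨Circle.exp z.arg, by rw [Circle.coe_exp]; exact Complex.norm_mul_exp_arg_mul_I z⟩
  rw [← hausdorffMeasure_circle_preimage_mul_left v {w : Circle | ((‖z‖ : ℝ) : ℂ) * w ∈ A}]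
  congr 1
  ext w
  simp only [mem_ofPred_eq, preimage_ofPred_eq, Circle.coe_mul]
  rw [← mul_assoc, hv, mul_comm]

/-- A compact symmetric interval containing the origin has length at least `2 s` if and only if it
contains `s`. -/
theorem two_mul_le_volume_iff {S : Set ℝ} (hconv : Convex ℝ S) (hcomp : IsCompact S)
    (hsym : ∀ x ∈ S, -x ∈ S) {s : ℝ} (hs : 0 < s) :
    ENNReal.ofReal (2 * s) ≤ volume S ↔ s ∈ S := by
  constructor
  · intro h
    have hne : S.Nonempty := by
      rw [nonempty_iff_ne_empty]
      rintro rfl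
      simp at h
      linarith
    obtain ⟨a, ha, hmax⟩ := hcomp.exists_isGreatest hne
    have hsub : S ⊆ Icc (-a) a := fun x hx => ⟨by linarith [hmax (hsym x hx)], hmax hx⟩
    have h2 := h.trans (measure_mono hsub)
    have ha0 : 0 ≤ a := by linarith [hmax (hsym a ha)]
    rw [Real.volume_Icc, ENNReal.ofReal_le_ofReal_iff (by linarith)] at h2
    exact hconv.ordConnected.out (hsym a ha) ha ⟨by linarith, by linarith⟩
  · intro h
    have hsub : Icc (-s) s ⊆ S := hconv.ordConnected.out (hsym s h) h
    refine le_trans (le_of_eq ?_) (measure_mono hsub)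
    rw [Real.volume_Icc]
    congr 1
    ring

theorem complexIso_inner_eq_zero_iff (w : Circle) (x : Euc 2) :
    ⟪x, complexIso w⟫ = 0 ↔ ∃ r : ℝ, complexIso (r * (Complex.I * w)) = x := by
  obtain ⟨z, rfl⟩ := complexIso.surjective x
  have hw : (w : ℂ).re * (w : ℂ).re + (w : ℂ).im * (w : ℂ).im = 1 := by
    have := Circle.normSq_coe w
    rwa [Complex.normSq_apply] at this
  rw [LinearIsometryEquiv.inner_map_map, Complex.inner]
  simp only [EmbeddingLike.apply_eq_iff_eq]
  constructor
  · intro h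
    simp at h
    refine ⟨z.im * (w : ℂ).re - z.re * (w : ℂ).im, ?_⟩
    apply Complex.ext <;> simp <;> grind
  · rintro ⟨r, rfl⟩
    simp
    ring

theorem le_sectionVol_iff {K : Set (Euc 2)} (hconv : Convex ℝ K) (hcomp : IsCompact K)
    (hsym : K = -K) (w : Circle) {s : ℝ} (hs : 0 < s) :
    ENNReal.ofReal (2 * s) ≤ sectionVol 2 K (complexIso w) ↔
      complexIso (s * (Complex.I * w)) ∈ K := by
  set f : ℝ →ₗ[ℝ] Euc 2 := LinearMap.toSpanSingleton ℝ (Euc 2) (complexIso (Complex.I * w))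
  have hf : ∀ r : ℝ, f r = complexIso (r * (Complex.I * w)) := fun r => by
    rw [← Complex.real_smul, map_smul]
    rfl
  have hiso : Isometry f := AddMonoidHomClass.isometry_of_norm f fun r => by
    rw [hf, LinearIsometryEquiv.norm_map, norm_mul, norm_mul, Circle.norm_coe]
    simp
  have himage : K ∩ {x : Euc 2 | ⟪x, complexIso w⟫ = 0} = f '' (f ⁻¹' K) := by
    rw [image_preimage_eq_inter_range]
    congr 1
    ext x
    simp only [mem_ofPred_eq, complexIso_inner_eq_zero_iff, mem_range, hf]
  have hvol : sectionVol 2 K (complexIso w) = volume (f ⁻¹' K) := by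
    rw [sectionVol, himage, show ((2 : ℕ) : ℝ) - 1 = 1 by norm_num,
      hiso.hausdorffMeasure_image (Or.inl zero_le_one), hausdorffMeasure_real]
  rw [hvol, two_mul_le_volume_iff (hconv.linear_preimage f)
    (hiso.isClosedEmbedding.isCompact_preimage hcomp) (fun x hx => ?_) hs, mem_preimage, hf]
  rw [mem_preimage, map_neg, hsym, Set.mem_neg, neg_neg]
  exact hx

theorem hausdorffMeasure_image_circle (B : Set Circle) :
    μH[1] ((fun w : Circle => complexIso w) '' B) = μH[1] B :=
  (complexIso.isometry.comp isometry_circle_coe).hausdorffMeasure_image (Or.inl zero_le_one) B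

theorem range_complexIso_circle :
    range (fun w : Circle => complexIso w) = sphere (0 : Euc 2) 1 := by
  ext x
  obtain ⟨z, rfl⟩ := complexIso.surjective x
  simp only [mem_range, EmbeddingLike.apply_eq_iff_eq, mem_sphere_zero_iff_norm,
    LinearIsometryEquiv.norm_map]
  constructor
  · rintro ⟨w, rfl⟩
    exact Circle.norm_coe w
  · intro hz
    exact ⟨⟨z, by simpa [Submonoid.unitSphere] using hz⟩, rfl⟩

theorem Sdist_two_mul {K : Set (Euc 2)} (hconv : Convex ℝ K) (hcomp : IsCompact K)
    (hsym : K = -K) {s : ℝ} (hs : 0 < s) :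
    Sdist 2 K (2 * s) =
      μH[1] {w : Circle | (s : ℂ) * w ∈ complexIso ⁻¹' K} / μH[1] (univ : Set Circle) := by
  obtain ⟨v, hv⟩ : ∃ v : Circle, (v : ℂ) = Complex.I :=
    ⟨⟨Complex.I, by simp [Submonoid.unitSphere]⟩, rfl⟩
  rw [Sdist, sphHaar, show ((2 : ℕ) : ℝ) - 1 = 1 by norm_num, ← range_complexIso_circle,
    ← image_univ, hausdorffMeasure_image_circle, image_univ, ← image_preimage_eq_inter_range,
    hausdorffMeasure_image_circle,
    ← hausdorffMeasure_circle_preimage_mul_left v {w : Circle | (s : ℂ) * w ∈ complexIso ⁻¹' K}]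
  congr 2
  ext w
  simp only [preimage_ofPred_eq, mem_ofPred_eq, mem_preimage, Circle.coe_mul, hv]
  exact le_sectionVol_iff hconv hcomp hsym w hs

/-- If `K, L` are origin-symmetric convex bodies in `ℝ²` containing the
origin in their interiors with `S_K(t) ≤ S_L(t)` for all `t ≥ 0`, then `|K| ≤ |L|`. -/
theorem stmt_0 (K L : Set (Euc 2))
    (hK : IsConvexBody K) (hL : IsConvexBody L)
    (hKsym : K = -K) (hLsym : L = -L)
    (hK0 : (0 : Euc 2) ∈ interior K) (hL0 : (0 : Euc 2) ∈ interior L)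
    (h : ∀ t : ℝ, 0 ≤ t → Sdist 2 K t ≤ Sdist 2 L t) :
    volume K ≤ volume L := by
  have hpre : ∀ A : Set (Euc 2), IsCompact A → volume (complexIso ⁻¹' A) = volume A := fun A hA =>
    complexIso.measurePreserving.measure_preimage hA.measurableSet.nullMeasurableSet
  rw [← hpre K hK.2.1, ← hpre L hL.2.1,
    ← ENNReal.mul_le_mul_iff_right hausdorffMeasure_circle_univ_pos.ne'
      hausdorffMeasure_circle_univ_lt_top.ne,
    hausdorffMeasure_circle_mul_volume (hK.2.1.isClosed.preimage complexIso.continuous),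
    hausdorffMeasure_circle_mul_volume (hL.2.1.isClosed.preimage complexIso.continuous)]
  refine lintegral_mono fun z => ?_
  rcases eq_or_ne z 0 with rfl | hz
  · exact measure_mono fun w _ => by simpa using interior_subset hL0
  · have hs : 0 < ‖z‖ := norm_pos_iff.2 hz
    have := h (2 * ‖z‖) (by positivity)
    rw [Sdist_two_mul hK.1 hK.2.1 hKsym hs, Sdist_two_mul hL.1 hL.2.1 hLsym hs] at this
    rwa [ENNReal.div_le_iff hausdorffMeasure_circle_univ_pos.ne'
      hausdorffMeasure_circle_univ_lt_top.ne, ENNReal.div_mul_cancel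
      hausdorffMeasure_circle_univ_pos.ne' hausdorffMeasure_circle_univ_lt_top.ne] at this
end
end

section
/- There exist origin-symmetric convex bodies K and L in the Euclidean plane R^2 such that Π_K(t) = Π_L(t) for all t ≥ 0, but |K| ≠ |L|. -/
open MeasureTheory Metric Set
open scoped RealInnerProductSpace ENNReal NNReal

noncomputable section

/-- The part of the unit circle lying in the half-plane `⟪·, w⟫ ≥ σ`. -/
def circleCap (w : Euc 2) (σ : ℝ) : Set (Euc 2) :=
  {p | ‖p‖ = 1 ∧ σ ≤ ⟪p, w⟫}

theorem euc_two_inner (p q : Euc 2) : ⟪p, q⟫ = p 0 * q 0 + p 1 * q 1 := by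
  simp [PiLp.inner_apply, Fin.sum_univ_two, mul_comm]

theorem euc_two_norm_eq_one_iff (p : Euc 2) : ‖p‖ = 1 ↔ p 0 ^ 2 + p 1 ^ 2 = 1 := by
  rw [EuclideanSpace.norm_eq, Real.sqrt_eq_one]
  simp [Fin.sum_univ_two]

theorem euc_two_ext {p q : Euc 2} (h₀ : p 0 = q 0) (h₁ : p 1 = q 1) : p = q := by
  ext i
  fin_cases i
  · exact h₀
  · exact h₁

theorem isClosed_circleCap (w : Euc 2) (σ : ℝ) : IsClosed (circleCap w σ) :=
  have h₁ : IsClosed {p : Euc 2 | ‖p‖ = 1} := isClosed_eq (by fun_prop) (by fun_prop)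
  have h₂ : IsClosed {p : Euc 2 | σ ≤ ⟪p, w⟫} := isClosed_le (by fun_prop) (by fun_prop)
  h₁.inter h₂

theorem hausdorffMeasure_circleCap {v w : Euc 2} (h : ‖v‖ = ‖w‖) (σ : ℝ) :
    μH[1] (circleCap v σ) = μH[1] (circleCap w σ) := by
  let R := (ℝ ∙ (v - w))ᗮ.reflection
  have hR : R v = w := Submodule.reflection_sub h
  have hpre : R ⁻¹' circleCap w σ = circleCap v σ := by
    ext p
    simp only [circleCap, mem_preimage, mem_ofPred_eq, LinearIsometryEquiv.norm_map, ← hR,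
      LinearIsometryEquiv.inner_map_map]
  rw [← hpre]
  exact R.toIsometryEquiv.hausdorffMeasure_preimage 1 _

/-- The sign attached to a Boolean. -/
def boolSign (b : Bool) : ℝ := if b then 1 else -1

/-- The union of the four caps centred at `(±A, ±B)`, which overlap at most at `(±1, 0)`. -/
theorem hausdorffMeasure_four_caps {A B σ : ℝ} (hA : 0 ≤ A) (hB : 0 ≤ B)
    (hAB : A ^ 2 + B ^ 2 = 1) (hAσ : A ≤ σ) (hBσ : B < σ) :
    μH[1] {p : Euc 2 | ‖p‖ = 1 ∧ σ ≤ A * |p 0| + B * |p 1|} =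
      4 * μH[1] (circleCap !₂[1, 0] σ) := by
  let c : Bool × Bool → Euc 2 := fun b => !₂[boolSign b.1 * A, boolSign b.2 * B]
  have hsign (b : Bool) : boolSign b ^ 2 = 1 := by cases b <;> norm_num [boolSign]
  have hunion : {p : Euc 2 | ‖p‖ = 1 ∧ σ ≤ A * |p 0| + B * |p 1|} =
      ⋃ b, circleCap (c b) σ := by
    ext p
    simp only [circleCap, mem_ofPred_eq, mem_iUnion, exists_and_left, euc_two_inner, c]
    refine and_congr_right fun _ => ⟨fun hp => ?_, fun ⟨b, hb⟩ => hb.trans ?_⟩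
    · refine ⟨(decide (0 ≤ p 0), decide (0 ≤ p 1)), hp.trans (le_of_eq ?_)⟩
      have key (x : ℝ) : |x| = boolSign (decide (0 ≤ x)) * x := by
        by_cases hx : 0 ≤ x
        · simp [boolSign, hx, abs_of_nonneg hx]
        · simp [boolSign, hx, abs_of_neg (not_le.1 hx)]
      rw [key (p 0), key (p 1)]
      simp
      ring
    · have key (d : Bool) (x : ℝ) : x * boolSign d ≤ |x| := by
        cases d
        · simpa [boolSign] using neg_le_abs x
        · simpa [boolSign] using le_abs_self x
      have h₀ := mul_le_mul_of_nonneg_left (key b.1 (p 0)) hA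
      have h₁ := mul_le_mul_of_nonneg_left (key b.2 (p 1)) hB
      simp
      linarith
  have hnorm (b) : ‖c b‖ = ‖(!₂[1, 0] : Euc 2)‖ := by
    rw [(euc_two_norm_eq_one_iff (c b)).2, (euc_two_norm_eq_one_iff _).2]
    · simp
    · simp only [c]
      simp [mul_pow, hsign, hAB]
  have hdisj : Pairwise (Function.onFun (AEDisjoint μH[1]) fun b => circleCap (c b) σ) := by
    intro b d hbd
    have := Measure.nullSingletonClass_hausdorff (Euc 2) one_pos
    refine measure_mono_null (t := {!₂[1, 0], !₂[-1, 0]}) ?_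
      ((Set.toFinite _).measure_zero _)
    rintro p ⟨⟨hp, hb⟩, ⟨-, hd⟩⟩
    rw [euc_two_norm_eq_one_iff] at hp
    rw [euc_two_inner] at hb hd
    have hx : |p 0| ≤ 1 := abs_le_one_iff_mul_self_le_one.2 (by nlinarith)
    have hy : |p 1| ≤ 1 := abs_le_one_iff_mul_self_le_one.2 (by nlinarith)
    rw [abs_le] at hx hy
    have hx1 : 0 ≤ A * (1 - p 0) := mul_nonneg hA (by linarith)
    have hx2 : 0 ≤ A * (1 + p 0) := mul_nonneg hA (by linarith)
    have hy1 : 0 ≤ B * (1 - p 1) := mul_nonneg hB (by linarith)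
    have hy2 : 0 ≤ B * (1 + p 1) := mul_nonneg hB (by linarith)
    have hpx : p 0 = 1 ∨ p 0 = -1 := by
      rcases b with ⟨b₁, b₂⟩
      rcases d with ⟨d₁, d₂⟩
      have hσ : 0 < σ := by linarith
      have hx3 : 0 ≤ (σ - A) * (1 - p 0) := mul_nonneg (by linarith) (by linarith)
      have hx4 : 0 ≤ (σ - A) * (1 + p 0) := mul_nonneg (by linarith) (by linarith)
      cases b₁ <;> cases b₂ <;> cases d₁ <;> cases d₂ <;>
        simp [boolSign, c] at hb hd hbd <;>
        first
        | (exfalso; linarith)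
        | (left; nlinarith)
        | (right; nlinarith)
    rcases hpx with h | h
    · left
      exact euc_two_ext (by simpa using h) (by simp; nlinarith)
    · right
      exact euc_two_ext (by simpa using h) (by simp; nlinarith)
  rw [hunion, measure_iUnion₀ hdisj fun b => (isClosed_circleCap _ _).nullMeasurableSet,
    tsum_fintype, Finset.sum_congr rfl fun b _ => hausdorffMeasure_circleCap (hnorm b) σ]
  simp

/-- Widths of a symmetric planar convex set are twice the values of its support function. -/
theorem projVol_two_eq {K : Set (Euc 2)} (hc : Convex ℝ K) (hs : K = -K) {θ p : Euc 2}
    (hθ : ‖θ‖ = 1) {h : ℝ} (hh : 0 < h) (hp : p ∈ K)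
    (hph : p 0 * -θ 1 + p 1 * θ 0 = h)
    (hle : ∀ q ∈ K, q 0 * -θ 1 + q 1 * θ 0 ≤ h) :
    projVol 2 K θ = ENNReal.ofReal (2 * h) := by
  set w : Euc 2 := !₂[-θ 1, θ 0] with hw
  have hθ' := (euc_two_norm_eq_one_iff θ).1 hθ
  have hproj (x : Euc 2) : x - ⟪x, θ⟫ • θ = (x 0 * -θ 1 + x 1 * θ 0) • w := by
    apply euc_two_ext
    · simp [euc_two_inner, hw]
      linear_combination x 0 * -hθ'
    · simp [euc_two_inner, hw]
      linear_combination x 1 * -hθ'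
  have hnw : ‖w‖ = 1 := (euc_two_norm_eq_one_iff w).2 (by simp [hw]; linarith)
  have himage : (fun x => x - ⟪x, θ⟫ • θ) '' K = segment ℝ (-(h • w)) (h • w) := by
    simp only [hproj]
    have hnp : -p ∈ K := by rw [hs]; simpa using hp
    apply Subset.antisymm
    · rintro _ ⟨q, hq, rfl⟩
      have h₁ := hle q hq
      have h₂ : -h ≤ q 0 * -θ 1 + q 1 * θ 0 := by
        have := hle (-q) (by rw [hs]; simpa using hq)
        simp at this
        linarith
      change (q 0 * -θ 1 + q 1 * θ 0) • w ∈ _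
      generalize q 0 * -θ 1 + q 1 * θ 0 = a at *
      refine ⟨(h - a) / (2 * h), (h + a) / (2 * h), div_nonneg (by linarith) (by linarith),
        div_nonneg (by linarith) (by linarith), by field_simp; ring, ?_⟩
      match_scalars
      field_simp
      ring
    · rintro _ ⟨a, b, ha, hb, hab, rfl⟩
      refine ⟨a • -p + b • p, hc hnp hp ha hb hab, ?_⟩
      rw [← hph]
      simp
      module
  unfold projVol
  rw [himage, show ((2 : ℕ) : ℝ) - 1 = 1 by norm_num, hausdorffMeasure_segment, edist_dist,
    dist_eq_norm]
  congr 1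
  rw [show -(h • w) - h • w = (-(2 * h)) • w by module, norm_smul, hnw]
  simp [abs_of_pos hh]

/-- The square `[-1, 1]²`. -/
def squareBody : Set (Euc 2) := {p | |p 0| ≤ 1 ∧ |p 1| ≤ 1}

/-- The body with support function `√(1 + |y|)` on the unit circle. -/
def sqrtBody : Set (Euc 2) :=
  {p | ∀ x y : ℝ, x ^ 2 + y ^ 2 = 1 → p 0 * x + p 1 * y ≤ √(1 + |y|)}

theorem squareBody_symm : squareBody = -squareBody := by
  ext p
  simp [squareBody]

theorem sqrtBody_symm : sqrtBody = -sqrtBody := by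
  ext p
  constructor
  · intro hp x y hxy
    simpa using hp (-x) (-y) (by simpa using hxy)
  · intro hp x y hxy
    simpa using hp (-x) (-y) (by simpa using hxy)

theorem isCompact_of_coord_bounds {K : Set (Euc 2)} (hK : IsClosed K)
    (hb : ∀ p ∈ K, |p 0| ≤ 2 ∧ |p 1| ≤ 2) : IsCompact K := by
  refine (isCompact_closedBall (0 : Euc 2) 3).of_isClosed_subset hK fun p hp => ?_
  obtain ⟨h₀, h₁⟩ := hb p hp
  rw [abs_le] at h₀ h₁
  rw [mem_closedBall_zero_iff, EuclideanSpace.norm_eq, Real.sqrt_le_left (by norm_num)]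
  simp [Fin.sum_univ_two]
  nlinarith

theorem interior_nonempty_of_unit_ball {K : Set (Euc 2)}
    (hb : ∀ p : Euc 2, p 0 ^ 2 + p 1 ^ 2 ≤ 1 → p ∈ K) : (interior K).Nonempty := by
  refine ⟨0, mem_interior.2 ⟨ball 0 1, fun p hp => hb p ?_, isOpen_ball, by simp⟩⟩
  rw [mem_ball_zero_iff, EuclideanSpace.norm_eq, Real.sqrt_lt' (by norm_num)] at hp
  simp [Fin.sum_univ_two] at hp
  exact hp.le

theorem isConvexBody_squareBody : IsConvexBody squareBody := by
  refine ⟨?_, isCompact_of_coord_bounds ?_ ?_, interior_nonempty_of_unit_ball ?_⟩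
  · rintro p ⟨hp₀, hp₁⟩ q ⟨hq₀, hq₁⟩ a b ha hb hab
    rw [abs_le] at *
    simp only [squareBody, mem_ofPred_eq, abs_le]
    simp
    refine ⟨⟨?_, ?_⟩, ?_, ?_⟩ <;> nlinarith
  · have hi (i : Fin 2) : IsClosed {p : Euc 2 | |p i| ≤ 1} :=
      isClosed_le (by fun_prop) (by fun_prop)
    exact (hi 0).inter (hi 1)
  · exact fun p hp => ⟨hp.1.trans one_le_two, hp.2.trans one_le_two⟩
  · intro p hp
    exact ⟨abs_le_one_iff_mul_self_le_one.2 (by nlinarith),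
      abs_le_one_iff_mul_self_le_one.2 (by nlinarith)⟩

theorem isConvexBody_sqrtBody : IsConvexBody sqrtBody := by
  refine ⟨?_, isCompact_of_coord_bounds ?_ ?_, interior_nonempty_of_unit_ball ?_⟩
  · intro p hp q hq a b ha hb hab x y hxy
    have h₁ := mul_le_mul_of_nonneg_left (hp x y hxy) ha
    have h₂ := mul_le_mul_of_nonneg_left (hq x y hxy) hb
    have h₃ : √(1 + |y|) = a * √(1 + |y|) + b * √(1 + |y|) := by rw [← add_mul, hab, one_mul]
    simp
    linarith
  · simp only [sqrtBody, ofPred_forall]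
    exact isClosed_iInter fun x => isClosed_iInter fun y => isClosed_iInter fun _ =>
      isClosed_le (by fun_prop) (by fun_prop)
  · intro p hp
    have h₀ := hp 1 0 (by norm_num)
    have h₁ := hp (-1) 0 (by norm_num)
    have h₂ := hp 0 1 (by norm_num)
    have h₃ := hp 0 (-1) (by norm_num)
    have h₄ : √(1 + 1) ≤ 2 := by rw [Real.sqrt_le_left] <;> norm_num
    simp at h₀ h₁ h₂ h₃
    simp only [abs_le]
    refine ⟨⟨?_, ?_⟩, ?_, ?_⟩ <;> linarith
  · intro p hp x y hxy
    apply Real.le_sqrt_of_sq_le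
    nlinarith [sq_nonneg (p 0 * y - p 1 * x), abs_nonneg y]

theorem abs_add_abs_pos_of_norm_eq_one {θ : Euc 2} (hθ : ‖θ‖ = 1) : 0 < |θ 0| + |θ 1| := by
  rw [euc_two_norm_eq_one_iff] at hθ
  by_contra! hle
  have h₀ : θ 0 = 0 := abs_nonpos_iff.1 (by linarith [abs_nonneg (θ 1)])
  have h₁ : θ 1 = 0 := abs_nonpos_iff.1 (by linarith [abs_nonneg (θ 0)])
  simp [h₀, h₁] at hθ

theorem projVol_squareBody {θ : Euc 2} (hθ : ‖θ‖ = 1) :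
    projVol 2 squareBody θ = ENNReal.ofReal (2 * (|θ 0| + |θ 1|)) := by
  refine projVol_two_eq isConvexBody_squareBody.1 squareBody_symm hθ
    (abs_add_abs_pos_of_norm_eq_one hθ)
    (p := !₂[-SignType.sign (θ 1), SignType.sign (θ 0)]) ?_ ?_ ?_
  · have (x : ℝ) : |(SignType.sign x : ℝ)| ≤ 1 := by
      cases SignType.sign x <;> simp
    simp [squareBody, this]
  · simp
    rw [add_comm]
  · rintro q ⟨h₀, h₁⟩
    have h₂ : |q 0 * -θ 1| ≤ |θ 1| := by
      rw [abs_mul, abs_neg]; exact mul_le_of_le_one_left (abs_nonneg _) h₀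
    have h₃ : |q 1 * θ 0| ≤ |θ 0| := by
      rw [abs_mul]; exact mul_le_of_le_one_left (abs_nonneg _) h₁
    linarith [le_abs_self (q 0 * -θ 1), le_abs_self (q 1 * θ 0)]

/-- Half-angle parametrisation of the unit circle. -/
theorem exists_half_angle {x y : ℝ} (h : x ^ 2 + y ^ 2 = 1) :
    ∃ s c : ℝ, s ^ 2 + c ^ 2 = 1 ∧ c = √((1 + y) / 2) ∧ x = 2 * s * c ∧ y = c ^ 2 - s ^ 2 := by
  have hy : -1 ≤ y := by nlinarith
  have hsq := Real.sq_sqrt (show 0 ≤ (1 + y) / 2 by linarith)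
  rcases hy.eq_or_lt with rfl | hy'
  · exact ⟨1, 0, by norm_num, by norm_num, by nlinarith, by norm_num⟩
  · have hc : √((1 + y) / 2) ≠ 0 := (Real.sqrt_pos.2 (by linarith)).ne'
    generalize √((1 + y) / 2) = c at *
    have h1 : (x / (2 * c)) ^ 2 = (1 - y) / 2 := by
      field_simp
      nlinarith
    exact ⟨x / (2 * c), c, by linarith, rfl, by field_simp, by linarith⟩

theorem two_mul_half_sqrt (y : ℝ) : √2 * √((1 + y) / 2) = √(1 + y) := by
  rw [← Real.sqrt_mul (by norm_num)]
  congr 1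
  ring

/-- The boundary point of `sqrtBody` with outer normal `(2sc, c² - s²)`. -/
theorem boundary_point_mem_sqrtBody {s c : ℝ} (h : s ^ 2 + c ^ 2 = 1) (hc : 0 ≤ c) :
    (!₂[√2 * (s * (1 / 2 + c ^ 2)), √2 * c ^ 3] : Euc 2) ∈ sqrtBody := by
  intro x y hxy
  obtain ⟨t, d, htd, hd, rfl, rfl⟩ := exists_half_angle hxy
  have hd0 : 0 ≤ d := hd ▸ Real.sqrt_nonneg _
  have hle : s * (1 / 2 + c ^ 2) * (2 * t * d) + c ^ 3 * (d ^ 2 - t ^ 2) ≤ d := by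
    set e := c * d + s * t with he
    have he1 : e ^ 2 + (s * d - c * t) ^ 2 = 1 := by
      rw [he]
      linear_combination (d ^ 2 + t ^ 2) * h + htd
    have hid : d - (s * (1 / 2 + c ^ 2) * (2 * t * d) + c ^ 3 * (d ^ 2 - t ^ 2)) =
        (1 - e) * (d + c * (1 + e)) := by
      rw [he]
      linear_combination c * t ^ 2 * h + c * htd
    have : 0 ≤ (1 - e) * (d + c * (1 + e)) := by
      refine mul_nonneg (by nlinarith) (add_nonneg hd0 (mul_nonneg hc (by nlinarith)))
    linarith
  calc _ = √2 * (s * (1 / 2 + c ^ 2) * (2 * t * d) + c ^ 3 * (d ^ 2 - t ^ 2)) := by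
        simp
        ring
    _ ≤ √2 * d := by gcongr
    _ = √(1 + (d ^ 2 - t ^ 2)) := by
        conv_lhs => rw [hd]
        exact two_mul_half_sqrt _
    _ ≤ _ := Real.sqrt_le_sqrt (by linarith [le_abs_self (d ^ 2 - t ^ 2)])

theorem exists_mem_sqrtBody_of_nonneg {x y : ℝ} (h : x ^ 2 + y ^ 2 = 1) (hy : 0 ≤ y) :
    ∃ p ∈ sqrtBody, p 0 * x + p 1 * y = √(1 + |y|) := by
  obtain ⟨s, c, hsc, hc, rfl, rfl⟩ := exists_half_angle h
  refine ⟨_, boundary_point_mem_sqrtBody hsc (hc ▸ Real.sqrt_nonneg _), ?_⟩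
  rw [abs_of_nonneg hy, ← two_mul_half_sqrt, ← hc]
  simp
  linear_combination √2 * (c + c ^ 3) * hsc

theorem exists_mem_sqrtBody {x y : ℝ} (h : x ^ 2 + y ^ 2 = 1) :
    ∃ p ∈ sqrtBody, p 0 * x + p 1 * y = √(1 + |y|) := by
  rcases le_total 0 y with hy | hy
  · exact exists_mem_sqrtBody_of_nonneg h hy
  · obtain ⟨p, hp, hpe⟩ := exists_mem_sqrtBody_of_nonneg (x := -x) (y := -y) (by simpa using h)
      (by linarith)
    refine ⟨-p, by rw [sqrtBody_symm]; simpa using hp, ?_⟩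
    simpa using hpe

theorem projVol_sqrtBody {θ : Euc 2} (hθ : ‖θ‖ = 1) :
    projVol 2 sqrtBody θ = ENNReal.ofReal (2 * √(1 + |θ 0|)) := by
  have hu : (-θ 1) ^ 2 + θ 0 ^ 2 = 1 := by
    have := (euc_two_norm_eq_one_iff θ).1 hθ
    linarith
  obtain ⟨p, hp, hpe⟩ := exists_mem_sqrtBody hu
  exact projVol_two_eq isConvexBody_sqrtBody.1 sqrtBody_symm hθ (by positivity) hp hpe
    fun q hq => hq _ _ hu

theorem hausdorffMeasure_superlevel_eq (s : ℝ) :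
    μH[1] {θ : Euc 2 | ‖θ‖ = 1 ∧ s ≤ |θ 0| + |θ 1|} =
      μH[1] {θ : Euc 2 | ‖θ‖ = 1 ∧ s ≤ √(1 + |θ 0|)} := by
  rcases le_or_gt s 1 with hs | hs
  · congr 1
    ext θ
    simp only [mem_ofPred_eq, euc_two_norm_eq_one_iff]
    refine and_congr_right fun hθ => iff_of_true ?_ ?_
    · refine hs.trans ?_
      rw [← sq_abs (θ 0), ← sq_abs (θ 1)] at hθ
      nlinarith [abs_nonneg (θ 0), abs_nonneg (θ 1)]
    · exact hs.trans (Real.one_le_sqrt.2 (by linarith [abs_nonneg (θ 0)]))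
  have h2 : (√2) ^ 2 = 2 := Real.sq_sqrt (by norm_num)
  have h2p : 0 < √2 := by positivity
  rcases le_or_gt s (√2) with hs2 | hs2
  · set σ := s / √2 with hσ
    have hsσ : s = √2 * σ := by rw [hσ]; field_simp
    have hσ1 : σ ≤ 1 := by rw [hσ, div_le_one h2p]; exact hs2
    have hσ0 : 0 < σ := by positivity
    have hσ2 : 1 < 2 * σ ^ 2 := by nlinarith
    have hh : (1 / √2) ^ 2 = 1 / 2 := by rw [div_pow, h2]; norm_num
    have hlt : 1 / √2 < σ := by rw [hσ]; gcongr
    have hc2 : √(1 - σ ^ 2) ^ 2 = 1 - σ ^ 2 := Real.sq_sqrt (by nlinarith)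
    have hc0 := Real.sqrt_nonneg (1 - σ ^ 2)
    have hK := hausdorffMeasure_four_caps (A := 1 / √2) (B := 1 / √2) (by positivity)
      (by positivity) (by rw [hh]; norm_num) hlt.le hlt
    have hL := hausdorffMeasure_four_caps (A := σ) (B := √(1 - σ ^ 2)) hσ0.le hc0
      (by rw [hc2]; ring) le_rfl (by nlinarith)
    convert hK.trans hL.symm using 2
    · ext θ
      simp only [mem_ofPred_eq]
      rw [hσ, ← mul_add, one_div_mul_eq_div, div_le_div_iff_of_pos_right h2p]
    · ext θ
      simp only [mem_ofPred_eq, euc_two_norm_eq_one_iff]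
      refine and_congr_right fun hθ => ?_
      rw [← sq_abs (θ 0), ← sq_abs (θ 1)] at hθ
      rw [Real.le_sqrt' (by linarith), hsσ, mul_pow, h2]
      have hX0 := abs_nonneg (θ 0)
      have hY0 := abs_nonneg (θ 1)
      generalize |θ 0| = X at *
      generalize |θ 1| = Y at *
      generalize √(1 - σ ^ 2) = c at *
      have hX1 : X ≤ 1 := by nlinarith
      have hid : (c * Y) ^ 2 - (σ * (1 - X)) ^ 2 = (1 - X) * (1 + X - 2 * σ ^ 2) := by
        linear_combination Y ^ 2 * hc2 + (1 - σ ^ 2) * hθ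
      constructor
      · intro hX
        have := mul_nonneg (sub_nonneg.2 hX1) (sub_nonneg.2 hX)
        have := abs_le_of_sq_le_sq (a := σ * (1 - X)) (b := c * Y) (by linarith) (by positivity)
        linarith [le_abs_self (σ * (1 - X))]
      · intro hXY
        rcases hX1.eq_or_lt with rfl | hX1
        · nlinarith
        · have h₁ : 0 ≤ σ * (1 - X) := mul_nonneg hσ0.le (by linarith)
          have h₂ : (σ * (1 - X)) ^ 2 ≤ (c * Y) ^ 2 := by
            apply pow_le_pow_left₀ h₁
            linarith
          have h₃ : 0 ≤ (1 - X) * (1 + X - 2 * σ ^ 2) := by linarith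
          linarith [nonneg_of_mul_nonneg_right h₃ (sub_pos.2 hX1)]
  · congr 1
    ext θ
    simp only [mem_ofPred_eq, euc_two_norm_eq_one_iff]
    refine and_congr_right fun hθ => iff_of_false (not_le.2 ?_) (not_le.2 ?_)
    · refine lt_of_le_of_lt ?_ hs2
      apply Real.le_sqrt_of_sq_le
      rw [← sq_abs (θ 0), ← sq_abs (θ 1)] at hθ
      nlinarith [sq_nonneg (|θ 0| - |θ 1|)]
    · refine lt_of_le_of_lt (Real.sqrt_le_sqrt ?_) hs2
      have : |θ 0| ≤ 1 := abs_le_one_iff_mul_self_le_one.2 (by nlinarith)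
      linarith

theorem piDist_squareBody_eq (t : ℝ) : PiDist 2 squareBody t = PiDist 2 sqrtBody t := by
  have key (K : Set (Euc 2)) (h : Euc 2 → ℝ) (h0 : ∀ θ, ‖θ‖ = 1 → 0 < h θ)
      (hK : ∀ θ, ‖θ‖ = 1 → projVol 2 K θ = ENNReal.ofReal (2 * h θ)) :
      {θ : Euc 2 | ENNReal.ofReal t ≤ projVol 2 K θ} ∩ sphere 0 1 =
        {θ : Euc 2 | ‖θ‖ = 1 ∧ t / 2 ≤ h θ} := by
    ext θ
    simp only [mem_inter_iff, mem_ofPred_eq, mem_sphere_zero_iff_norm]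
    rw [and_comm]
    refine and_congr_right fun hθ => ?_
    rw [hK θ hθ, ENNReal.ofReal_le_ofReal_iff (by linarith [h0 θ hθ]), div_le_iff₀' two_pos]
  unfold PiDist sphHaar
  rw [key squareBody (fun θ => |θ 0| + |θ 1|) (fun _ => abs_add_abs_pos_of_norm_eq_one)
      fun θ => projVol_squareBody,
    key sqrtBody (fun θ => √(1 + |θ 0|)) (fun θ _ => by positivity) fun θ => projVol_sqrtBody,
    show ((2 : ℕ) : ℝ) - 1 = 1 by norm_num, hausdorffMeasure_superlevel_eq]

theorem volume_squareBody : volume squareBody = 4 := by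
  rw [← (PiLp.volume_preserving_toLp (Fin 2)).measure_preimage
    isConvexBody_squareBody.2.1.isClosed.nullMeasurableSet]
  have : WithLp.toLp 2 ⁻¹' squareBody = Icc (-1 : Fin 2 → ℝ) 1 := by
    ext p
    simp [squareBody, Pi.le_def, Fin.forall_fin_two, abs_le]
    tauto
  rw [this, Real.volume_Icc_pi]
  norm_num

theorem mem_sqrtBody_of_abs_le {a b : ℝ}
    (hab : ∀ x y : ℝ, 0 ≤ x → 0 ≤ y → x ^ 2 + y ^ 2 = 1 → (a * x + b * y) ^ 2 ≤ 1 + y)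
    {p : Euc 2} (h₀ : |p 0| ≤ a) (h₁ : |p 1| ≤ b) : p ∈ sqrtBody := by
  intro x y hxy
  calc p 0 * x + p 1 * y ≤ |p 0 * x| + |p 1 * y| := add_le_add (le_abs_self _) (le_abs_self _)
    _ ≤ a * |x| + b * |y| := by rw [abs_mul, abs_mul]; gcongr
    _ ≤ _ := Real.le_sqrt_of_sq_le (hab _ _ (abs_nonneg _) (abs_nonneg _) (by simpa using hxy))

theorem four_lt_volume_sqrtBody : 4 < volume sqrtBody := by
  rw [← (PiLp.volume_preserving_toLp (Fin 2)).measure_preimage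
    isConvexBody_sqrtBody.2.1.isClosed.nullMeasurableSet]
  let lo : Fin 5 → Fin 2 → ℝ :=
    ![![-0.88, -0.91], ![0.88, -0.5], ![-1, -0.5], ![-0.52, 0.91], ![-0.52, -1.27]]
  let hi : Fin 5 → Fin 2 → ℝ :=
    ![![0.88, 0.91], ![1, 0.5], ![-0.88, 0.5], ![0.52, 1.27], ![0.52, -0.91]]
  have hdisj : Pairwise (Function.onFun Disjoint
      fun i => univ.pi fun j => Ioc (lo i j) (hi i j)) := by
    intro i k hik
    refine Set.disjoint_left.2 fun x hx hx' => ?_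
    simp only [mem_univ_pi, Fin.forall_fin_two, mem_Ioc] at hx hx'
    fin_cases i <;> fin_cases k <;> simp [lo, hi] at hik hx hx' <;> linarith
  have hsub : ⋃ i, (univ.pi fun j => Ioc (lo i j) (hi i j)) ⊆
      WithLp.toLp 2 ⁻¹' sqrtBody := by
    refine iUnion_subset fun i x hx => ?_
    simp only [mem_univ_pi, Fin.forall_fin_two, mem_Ioc] at hx
    have big {p : Euc 2} := @mem_sqrtBody_of_abs_le 0.88 0.91 (by
      intro x y hx hy hxy
      nlinarith [mul_nonneg hy (sq_nonneg (x - 0.866)), mul_nonneg hy (sq_nonneg (y - 0.5)),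
        sq_nonneg (y - 0.5)]) p
    have wide {p : Euc 2} := @mem_sqrtBody_of_abs_le 1 0.5 (by
      intro x y hx hy hxy
      nlinarith) p
    have tall {p : Euc 2} := @mem_sqrtBody_of_abs_le 0.52 1.27 (by
      intro x y hx hy hxy
      nlinarith [mul_nonneg hy (sq_nonneg (x - 0.5)), mul_nonneg hy (sq_nonneg (y - 0.866)),
        sq_nonneg (y - 0.866), mul_nonneg hx (sq_nonneg (y - 0.866))]) p
    fin_cases i <;> simp [lo, hi] at hx
    · exact big (abs_le.2 ⟨by simp; linarith, by simp; linarith⟩)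
        (abs_le.2 ⟨by simp; linarith, by simp; linarith⟩)
    · exact wide (abs_le.2 ⟨by simp; linarith, by simp; linarith⟩)
        (abs_le.2 ⟨by simp; linarith, by simp; linarith⟩)
    · exact wide (abs_le.2 ⟨by simp; linarith, by simp; linarith⟩)
        (abs_le.2 ⟨by simp; linarith, by simp; linarith⟩)
    · exact tall (abs_le.2 ⟨by simp; linarith, by simp; linarith⟩)
        (abs_le.2 ⟨by simp; linarith, by simp; linarith⟩)
    · exact tall (abs_le.2 ⟨by simp; linarith, by simp; linarith⟩)
        (abs_le.2 ⟨by simp; linarith, by simp; linarith⟩)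
  refine lt_of_lt_of_le ?_ (measure_mono hsub)
  rw [measure_iUnion hdisj fun i => MeasurableSet.univ_pi fun j => measurableSet_Ioc]
  simp only [tsum_fintype, Real.volume_pi_Ioc, Fin.sum_univ_five, Fin.prod_univ_two]
  simp [lo, hi]
  rw [← ENNReal.ofReal_ofNat 4]
  repeat rw [← ENNReal.ofReal_mul (by norm_num)]
  repeat rw [← ENNReal.ofReal_add (by norm_num) (by norm_num)]
  exact (ENNReal.ofReal_lt_ofReal_iff (by norm_num)).2 (by norm_num)

/-- There exist origin-symmetric convex bodies `K, L` in `ℝ²` with the same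
distribution function of lengths of projections but different areas. -/
theorem stmt_1 : ∃ K L : Set (Euc 2),
    IsConvexBody K ∧ IsConvexBody L ∧ K = -K ∧ L = -L ∧
    (∀ t : ℝ, 0 ≤ t → PiDist 2 K t = PiDist 2 L t) ∧
    volume K ≠ volume L :=
  ⟨squareBody, sqrtBody, isConvexBody_squareBody, isConvexBody_sqrtBody, squareBody_symm,
    sqrtBody_symm, fun t _ => piDist_squareBody_eq t,
    (volume_squareBody.trans_lt four_lt_volume_sqrtBody).ne⟩
end
end

section
/- There exist origin-symmetric convex bodies K and L in R^2 such that σ({θ ∈ S^1 : ρ_K(θ) ≥ t}) = σ({θ ∈ S^1 : ρ_L(θ) ≥ t}) for all t ≥ 0, and yet L ≠ U(K) for every linear isometry U of R^2; in particular the distribution of the radial function does not determine an origin-symmetric convex body in R^2 up to orthogonal transformations. -/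
open MeasureTheory Metric Set
open scoped RealInnerProductSpace ENNReal NNReal

noncomputable section

/-- The closed unit disk truncated by the two strips `|⟪x, u⟫| ≤ 9/10` and `|⟪x, w⟫| ≤ 9/10`. -/
def cutDisk (u w : Euc 2) : Set (Euc 2) :=
  {x | ‖x‖ ≤ 1 ∧ |⟪x, u⟫| ≤ 9 / 10 ∧ |⟪x, w⟫| ≤ 9 / 10}

/-- The directions in which the strip of direction `u` forces the radial function below `t`. -/
def capDirs (u : Euc 2) (t : ℝ) : Set (Euc 2) :=
  {x | x ∈ sphere (0 : Euc 2) 1 ∧ 9 / 10 < t * |⟪x, u⟫|}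

lemma isClosed_cutDisk (u w : Euc 2) : IsClosed (cutDisk u w) := by
  have hc : ∀ v : Euc 2, IsClosed {x : Euc 2 | |⟪x, v⟫| ≤ 9 / 10} := fun v =>
    isClosed_le (by fun_prop) continuous_const
  exact (isClosed_le continuous_norm continuous_const).inter ((hc u).inter (hc w))

lemma isCompact_cutDisk (u w : Euc 2) : IsCompact (cutDisk u w) := by
  refine (isCompact_closedBall (0 : Euc 2) 1).of_isClosed_subset (isClosed_cutDisk u w) ?_
  intro x hx
  simpa using hx.1

lemma convex_abs_inner_le (u : Euc 2) (r : ℝ) : Convex ℝ {x : Euc 2 | |⟪x, u⟫| ≤ r} := by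
  intro x hx y hy a b ha hb hab
  simp only [mem_ofPred_eq, inner_add_left, real_inner_smul_left, abs_le] at *
  obtain rfl : b = 1 - a := by linarith
  constructor <;> nlinarith [hx.1, hx.2, hy.1, hy.2]

lemma convex_cutDisk (u w : Euc 2) : Convex ℝ (cutDisk u w) := by
  have h : Convex ℝ {x : Euc 2 | ‖x‖ ≤ 1} := by
    simpa [closedBall] using convex_closedBall (0 : Euc 2) 1
  exact h.inter ((convex_abs_inner_le u _).inter (convex_abs_inner_le w _))

lemma cutDisk_eq_neg (u w : Euc 2) : cutDisk u w = -cutDisk u w := by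
  ext x
  simp [cutDisk]

lemma zero_mem_interior_cutDisk (u w : Euc 2) : (0 : Euc 2) ∈ interior (cutDisk u w) := by
  have ho' : ∀ v : Euc 2, IsOpen {x : Euc 2 | |⟪x, v⟫| < 9 / 10} := fun v =>
    isOpen_lt (by fun_prop) continuous_const
  have ho : IsOpen {x : Euc 2 | ‖x‖ < 1 ∧ |⟪x, u⟫| < 9 / 10 ∧ |⟪x, w⟫| < 9 / 10} :=
    (isOpen_lt continuous_norm continuous_const).inter ((ho' u).inter (ho' w))
  refine interior_maximal ?_ ho (by norm_num)
  rintro x ⟨h1, h2, h3⟩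
  exact ⟨h1.le, h2.le, h3.le⟩

lemma isConvexBody_cutDisk (u w : Euc 2) : IsConvexBody (cutDisk u w) :=
  ⟨convex_cutDisk u w, isCompact_cutDisk u w, 0, zero_mem_interior_cutDisk u w⟩

lemma smul_mem_cutDisk {u w x : Euc 2} (hx : ‖x‖ = 1) {t : ℝ} (ht : 0 ≤ t) :
    t • x ∈ cutDisk u w ↔ t ≤ 1 ∧ t * |⟪x, u⟫| ≤ 9 / 10 ∧ t * |⟪x, w⟫| ≤ 9 / 10 := by
  simp [cutDisk, norm_smul, real_inner_smul_left, abs_mul, abs_of_nonneg ht, hx]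

lemma le_radial_cutDisk {u w x : Euc 2} (hx : ‖x‖ = 1) {t : ℝ} (ht : 0 ≤ t) :
    t ≤ radial (cutDisk u w) x ↔ t • x ∈ cutDisk u w := by
  have hbdd : BddAbove {a : ℝ | 0 ≤ a ∧ a • x ∈ cutDisk u w} :=
    ⟨1, fun a ha => ((smul_mem_cutDisk hx ha.1).1 ha.2).1⟩
  constructor
  · intro h
    have hclosed : IsClosed {a : ℝ | 0 ≤ a ∧ a • x ∈ cutDisk u w} :=
      isClosed_Ici.inter ((isClosed_cutDisk u w).preimage (by fun_prop : Continuous fun a : ℝ => a • x))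
    have hmem := hclosed.csSup_mem
      ⟨0, le_rfl, (smul_mem_cutDisk hx le_rfl).2 (by norm_num)⟩ hbdd
    obtain ⟨h1, h2, h3⟩ := (smul_mem_cutDisk hx hmem.1).1 hmem.2
    exact (smul_mem_cutDisk hx ht).2 ⟨h.trans h1,
      (mul_le_mul_of_nonneg_right h (abs_nonneg _)).trans h2,
      (mul_le_mul_of_nonneg_right h (abs_nonneg _)).trans h3⟩
  · exact fun h => le_csSup hbdd ⟨ht, h⟩

lemma measurableSet_capDirs (u : Euc 2) (t : ℝ) : MeasurableSet (capDirs u t) :=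
  isClosed_sphere.measurableSet.inter
    (isOpen_lt (by fun_prop) (by fun_prop) : IsOpen {x : Euc 2 | 9 / 10 < t * |⟪x, u⟫|}).measurableSet

lemma hausdorffMeasure_capDirs_eq {u w : Euc 2} (h : ‖u‖ = ‖w‖) (d t : ℝ) :
    μH[d] (capDirs u t) = μH[d] (capDirs w t) := by
  set R := (ℝ ∙ (u - w))ᗮ.reflection
  have hR : R u = w := Submodule.reflection_sub h
  rw [← R.toIsometryEquiv.hausdorffMeasure_preimage d (capDirs w t)]
  congr 1
  ext x
  simp [capDirs, ← hR]

lemma le_radial_inter_sphere {u w : Euc 2} {t : ℝ} (ht : 0 ≤ t) (ht1 : t ≤ 1) :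
    {x | t ≤ radial (cutDisk u w) x} ∩ sphere (0 : Euc 2) 1 =
      sphere (0 : Euc 2) 1 \ (capDirs u t ∪ capDirs w t) := by
  ext x
  by_cases hx : ‖x‖ = 1
  · simp [capDirs, hx, le_radial_cutDisk hx ht, smul_mem_cutDisk hx ht, ht1]
  · simp [hx]

lemma eq_zero_of_one_le_abs {a b : ℝ} (h : a ^ 2 + b ^ 2 = 1) (ha : 1 ≤ |a|) : b = 0 := by
  have := one_le_sq_iff_one_le_abs a |>.2 ha
  nlinarith

lemma disjoint_capDirs {u w : Euc 2} (h : ∀ x : Euc 2, ‖x‖ = 1 →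
      |⟪x, u⟫| ≤ 9 / 10 ∨ |⟪x, w⟫| ≤ 9 / 10) {t : ℝ} (ht1 : t ≤ 1) :
    Disjoint (capDirs u t) (capDirs w t) := by
  rw [Set.disjoint_left]
  rintro x ⟨hx, hxu⟩ ⟨-, hxw⟩
  have hu := mul_le_of_le_one_left (abs_nonneg ⟪x, u⟫) ht1
  have hw := mul_le_of_le_one_left (abs_nonneg ⟪x, w⟫) ht1
  rcases h x (by simpa using hx) with h | h <;> linarith

lemma sphHaar_le_radial_cutDisk_eq {u w u' w' : Euc 2} (hu : ‖u‖ = 1) (hw : ‖w‖ = 1)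
    (hu' : ‖u'‖ = 1) (hw' : ‖w'‖ = 1) {t : ℝ} (ht : 0 ≤ t)
    (h : ∀ x : Euc 2, ‖x‖ = 1 → |⟪x, u⟫| ≤ 9 / 10 ∨ |⟪x, w⟫| ≤ 9 / 10)
    (h' : ∀ x : Euc 2, ‖x‖ = 1 → |⟪x, u'⟫| ≤ 9 / 10 ∨ |⟪x, w'⟫| ≤ 9 / 10) :
    sphHaar 2 {x | t ≤ radial (cutDisk u w) x} =
      sphHaar 2 {x | t ≤ radial (cutDisk u' w') x} := by
  unfold sphHaar
  generalize ((2 : ℕ) : ℝ) - 1 = d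
  rcases le_or_gt t 1 with ht1 | ht1
  · by_cases htop : μH[d] (sphere (0 : Euc 2) 1) = ⊤
    · simp [htop]
    have hsub : ∀ v v' : Euc 2, capDirs v t ∪ capDirs v' t ⊆ sphere (0 : Euc 2) 1 :=
      fun v v' => union_subset (fun x hx => hx.1) (fun x hx => hx.1)
    have hmeas : ∀ v v' : Euc 2, Disjoint (capDirs v t) (capDirs v' t) →
        μH[d] (sphere (0 : Euc 2) 1 \ (capDirs v t ∪ capDirs v' t)) =
          μH[d] (sphere (0 : Euc 2) 1) - (μH[d] (capDirs v t) + μH[d] (capDirs v' t)) := by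
      intro v v' hv
      rw [measure_sdiff (hsub v v')
        ((measurableSet_capDirs v t).union (measurableSet_capDirs v' t)).nullMeasurableSet
        (measure_ne_top_of_subset (hsub v v') htop),
        measure_union hv (measurableSet_capDirs v' t)]
    rw [le_radial_inter_sphere ht ht1, le_radial_inter_sphere ht ht1, hmeas u w (disjoint_capDirs h ht1),
      hmeas u' w' (disjoint_capDirs h' ht1), hausdorffMeasure_capDirs_eq (hu.trans hu'.symm),
      hausdorffMeasure_capDirs_eq (hw.trans hw'.symm)]
  · have hempty : ∀ v v' : Euc 2,
        {x | t ≤ radial (cutDisk v v') x} ∩ sphere (0 : Euc 2) 1 = ∅ := by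
      intro v v'
      refine eq_empty_of_forall_notMem fun x ⟨hx, hx1⟩ => ?_
      have hx1 : ‖x‖ = 1 := by simpa using hx1
      exact ht1.not_ge ((smul_mem_cutDisk hx1 ht).1 ((le_radial_cutDisk hx1 ht).1 hx)).1
    rw [hempty, hempty]

lemma exists_smul_mem_cutDisk {u w x : Euc 2} (hx : ‖x‖ = 1) (hu : |⟪x, u⟫| < 1)
    (hw : |⟪x, w⟫| < 1) : ∃ a : ℝ, 9 / 10 < a ∧ a • x ∈ cutDisk u w := by
  obtain ⟨m, hm, hm1⟩ := exists_between (max_lt hu hw)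
  obtain ⟨hmu, hmw⟩ := max_lt_iff.1 hm
  have hm0 : 0 < m := (abs_nonneg _).trans_lt hmu
  set a : ℝ := min 1 (9 / 10 / m)
  have ha : 9 / 10 < a := lt_min (by norm_num) (by rw [lt_div_iff₀ hm0]; linarith)
  have ham : a * m ≤ 9 / 10 := (le_div_iff₀ hm0).1 (min_le_right _ _)
  have ha0 : 0 ≤ a := by linarith
  exact ⟨a, ha, (smul_mem_cutDisk hx ha0).2 ⟨min_le_left _ _,
    (mul_le_mul_of_nonneg_left hmu.le ha0).trans ham,
    (mul_le_mul_of_nonneg_left hmw.le ha0).trans ham⟩⟩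

lemma one_le_abs_inner_of_image_eq {u w u' w' x : Euc 2} (U : Euc 2 ≃ₗᵢ[ℝ] Euc 2)
    (h : cutDisk u' w' = U '' cutDisk u w) (hx : ‖x‖ = 1)
    (hxuw : 1 ≤ |⟪x, u⟫| ∨ 1 ≤ |⟪x, w⟫|) : 1 ≤ |⟪U x, u'⟫| ∨ 1 ≤ |⟪U x, w'⟫| := by
  by_contra! hcon
  obtain ⟨a, ha, hmem⟩ := exists_smul_mem_cutDisk (by simpa using hx) hcon.1 hcon.2
  rw [h, ← map_smul, U.injective.mem_set_image, smul_mem_cutDisk hx (by linarith)] at hmem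
  rcases hxuw with h' | h' <;> nlinarith [hmem.2.1, hmem.2.2]

lemma inner_euc_two (x y : Euc 2) : ⟪x, y⟫ = x 0 * y 0 + x 1 * y 1 := by
  simp [PiLp.inner_apply, Fin.sum_univ_two, mul_comm]

lemma norm_eq_one_iff_euc_two (x : Euc 2) : ‖x‖ = 1 ↔ x 0 ^ 2 + x 1 ^ 2 = 1 := by
  simp [EuclideanSpace.norm_eq, Fin.sum_univ_two]

/-- There exist origin-symmetric convex bodies `K, L` in `ℝ²` whose radial
functions have the same distribution, yet `L` is not the image of `K` under any linear
isometry of `ℝ²`. -/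
theorem stmt_3 : ∃ K L : Set (Euc 2),
    IsConvexBody K ∧ IsConvexBody L ∧ K = -K ∧ L = -L ∧
    (0 : Euc 2) ∈ interior K ∧ (0 : Euc 2) ∈ interior L ∧
    (∀ t : ℝ, 0 ≤ t →
      sphHaar 2 {θ : Euc 2 | t ≤ radial K θ} =
      sphHaar 2 {θ : Euc 2 | t ≤ radial L θ}) ∧
    (∀ U : Euc 2 ≃ₗᵢ[ℝ] Euc 2, L ≠ (U : Euc 2 → Euc 2) '' K) := by
  let e : Euc 2 := !₂[1, 0]
  let f : Euc 2 := !₂[0, 1]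
  let g : Euc 2 := !₂[3 / 5, 4 / 5]
  have he : ‖e‖ = 1 := by simp [norm_eq_one_iff_euc_two, e]
  have hf : ‖f‖ = 1 := by simp [norm_eq_one_iff_euc_two, f]
  have hg : ‖g‖ = 1 := by norm_num [norm_eq_one_iff_euc_two, g]
  refine ⟨cutDisk e f, cutDisk e g, isConvexBody_cutDisk e f, isConvexBody_cutDisk e g,
    cutDisk_eq_neg e f, cutDisk_eq_neg e g, zero_mem_interior_cutDisk e f,
    zero_mem_interior_cutDisk e g, ?_, ?_⟩
  · intro t ht
    refine sphHaar_le_radial_cutDisk_eq he hf he hg ht ?_ ?_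
    · intro x hx
      rw [norm_eq_one_iff_euc_two] at hx
      by_contra! hcon
      simp only [inner_euc_two, e, f] at hcon
      norm_num [lt_abs] at hcon
      obtain ⟨h1 | h1, h2 | h2⟩ := hcon <;> nlinarith
    · intro x hx
      rw [norm_eq_one_iff_euc_two] at hx
      by_contra! hcon
      simp only [inner_euc_two, e, g] at hcon
      norm_num [lt_abs] at hcon
      obtain ⟨h1 | h1, h2 | h2⟩ := hcon <;> nlinarith [sq_nonneg (x 0 - 2 * x 1)]
  · intro U h
    have hUe := one_le_abs_inner_of_image_eq U h he (Or.inl (by simp [he]))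
    have hUf := one_le_abs_inner_of_image_eq U h hf (Or.inr (by simp [hf]))
    have hne : ‖U e‖ = 1 := by simpa using he
    have hnf : ‖U f‖ = 1 := by simpa using hf
    have horth : ⟪U e, U f⟫ = 0 := by
      rw [U.inner_map_map]; simp [inner_euc_two, e, f]
    rw [norm_eq_one_iff_euc_two] at hne hnf
    rw [inner_euc_two] at horth
    have key : ∀ x : Euc 2, x 0 ^ 2 + x 1 ^ 2 = 1 → (1 ≤ |⟪x, e⟫| ∨ 1 ≤ |⟪x, g⟫|) →
        x 1 = 0 ∨ x 0 = 3 / 4 * x 1 := by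
      rintro x hx (h | h)
      · exact Or.inl (eq_zero_of_one_le_abs hx (by simpa [inner_euc_two, e] using h))
      · right
        have := eq_zero_of_one_le_abs (a := ⟪x, g⟫) (b := 4 / 5 * x 0 - 3 / 5 * x 1)
          (by simp [inner_euc_two, g]; linarith) h
        linarith
    rcases key _ hne hUe with h1 | h1 <;> rcases key _ hnf hUf with h2 | h2 <;>
      rw [h1] at hne horth <;> rw [h2] at hnf horth <;> ring_nf at hne hnf horth <;>
      simp at horth <;> rcases horth with h0 | h0 <;> simp [h0] at hne hnf
end
end

section
/- Let n ≥ 2 and let K be an origin-symmetric convex body in R^n such that for some r > 0, S_K(t) = S_{rB₂ⁿ}(t) for all t ≥ 0, where rB₂ⁿ is the Euclidean ball of radius r centered at the origin. Then K = rB₂ⁿ. -/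
open MeasureTheory Metric Set
open scoped RealInnerProductSpace ENNReal NNReal

noncomputable section

open Module

section OrthogonalGroup

variable {E : Type*} [NormedAddCommGroup E] [InnerProductSpace ℝ E] [FiniteDimensional ℝ E]

/-- The orthogonal group of a finite-dimensional Euclidean space. -/
abbrev OrthGroup (E : Type*) [NormedAddCommGroup E] [InnerProductSpace ℝ E]
    [FiniteDimensional ℝ E] : Type _ :=
  unitary (E →L[ℝ] E)

lemma OrthGroup.norm_apply (g : OrthGroup E) (x : E) : ‖g.1 x‖ = ‖x‖ :=
  ContinuousLinearMap.norm_map_of_mem_unitary g.2 x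

lemma OrthGroup.inner_apply (g : OrthGroup E) (x y : E) : ⟪g.1 x, g.1 y⟫ = ⟪x, y⟫ :=
  ContinuousLinearMap.inner_map_map_of_mem_unitary g.2 x y

lemma OrthGroup.isometry (g : OrthGroup E) : Isometry (g.1 : E → E) :=
  AddMonoidHomClass.isometry_of_norm _ g.norm_apply

lemma OrthGroup.apply_inv_apply (g : OrthGroup E) (x : E) : g.1 ((g⁻¹).1 x) = x := by
  have h : g * g⁻¹ = 1 := mul_inv_cancel g
  have h' := congrArg (fun k : OrthGroup E => k.1 x) h
  exact h'

instance OrthGroup.compactSpace : CompactSpace (OrthGroup E) := by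
  have : ProperSpace (E →L[ℝ] E) := FiniteDimensional.proper ℝ _
  refine isCompact_iff_compactSpace.mp ?_
  refine (isCompact_closedBall (0 : E →L[ℝ] E) 1).of_isClosed_subset isClosed_unitary ?_
  intro g hg
  rw [mem_closedBall_zero_iff]
  refine ContinuousLinearMap.opNorm_le_bound _ zero_le_one fun x => ?_
  rw [one_mul]
  exact (ContinuousLinearMap.norm_map_of_mem_unitary hg x).le

lemma OrthGroup.continuous_apply :
    Continuous fun p : OrthGroup E × E => p.1.1 p.2 :=
  (continuous_subtype_val.comp continuous_fst).clm_apply continuous_snd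

lemma OrthGroup.continuous_apply_const (x : E) :
    Continuous fun g : OrthGroup E => g.1 x :=
  OrthGroup.continuous_apply.comp (Continuous.prodMk_left x)

/-- The orthogonal transformation underlying a linear isometry equivalence. -/
def OrthGroup.ofIsometry (f : E ≃ₗᵢ[ℝ] E) : OrthGroup E :=
  Unitary.linearIsometryEquiv.symm f

lemma OrthGroup.ofIsometry_apply (f : E ≃ₗᵢ[ℝ] E) (x : E) :
    (OrthGroup.ofIsometry f).1 x = f x := by
  simp [OrthGroup.ofIsometry]

/-- The orthogonal group acts transitively on orthogonal pairs of prescribed lengths. -/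
lemma OrthGroup.exists_apply_eq_pair {x y x' y' : E} (hx : ‖x‖ = ‖x'‖) (hy : ‖y‖ = ‖y'‖)
    (hxy : ⟪x, y⟫ = 0) (hxy' : ⟪x', y'⟫ = 0) :
    ∃ g : OrthGroup E, g.1 x = x' ∧ g.1 y = y' := by
  obtain ⟨f, hf⟩ : ∃ f : E ≃ₗᵢ[ℝ] E, f x = x' := ⟨_, Submodule.reflection_sub hx⟩
  have h1 : ‖f y‖ = ‖y'‖ := by rw [f.norm_map, hy]
  let R := (ℝ ∙ (f y - y'))ᗮ.reflection
  have hR : R (f y) = y' := Submodule.reflection_sub h1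
  have hx' : R x' = x' := by
    refine Submodule.reflection_mem_subspace_eq_self ?_
    rw [Submodule.mem_orthogonal_singleton_iff_inner_left, inner_sub_right, hxy', ← hf,
      f.inner_map_map, hxy, sub_zero]
  refine ⟨OrthGroup.ofIsometry (f.trans R), ?_, ?_⟩
  · rw [OrthGroup.ofIsometry_apply, LinearIsometryEquiv.trans_apply, hf, hx']
  · rw [OrthGroup.ofIsometry_apply, LinearIsometryEquiv.trans_apply, hR]

lemma OrthGroup.exists_apply_eq {x x' : E} (hx : ‖x‖ = ‖x'‖) :
    ∃ g : OrthGroup E, g.1 x = x' := by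
  obtain ⟨f, hf⟩ : ∃ f : E ≃ₗᵢ[ℝ] E, f x = x' := ⟨_, Submodule.reflection_sub hx⟩
  exact ⟨OrthGroup.ofIsometry f, by rw [OrthGroup.ofIsometry_apply, hf]⟩

variable (E) in
lemma OrthGroup.exists_invariant_measure :
    ∃ ν : Measure (OrthGroup E), IsFiniteMeasure ν ∧ ν.IsMulRightInvariant ∧
      ν.IsOpenPosMeasure := by
  let ν : Measure (OrthGroup E) := Measure.haar
  refine ⟨ν.inv, ?_, inferInstance, ?_⟩
  · refine ⟨?_⟩
    rw [Measure.inv_apply, Set.inv_univ]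
    exact isCompact_univ.measure_lt_top
  · refine ⟨fun U hU hne => ?_⟩
    rw [Measure.inv_apply]
    exact hU.inv.measure_ne_zero ν hne.inv

end OrthogonalGroup

section Sphere

variable {E : Type*} [NormedAddCommGroup E] [InnerProductSpace ℝ E]

/-- Parametrization of the open half-sphere centred at `e` by the unit ball of `eᗮ`. -/
def halfSphereMap (e : E) (z : (ℝ ∙ e)ᗮ) : E := (z : E) + √(1 - ‖z‖ ^ 2) • e

lemma continuous_halfSphereMap (e : E) : Continuous (halfSphereMap e) := by
  unfold halfSphereMap
  fun_prop

lemma contDiffAt_halfSphereMap (e : E) : ContDiffAt ℝ 1 (halfSphereMap e) 0 := by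
  have h1 : ContDiffAt ℝ 1 (fun z : (ℝ ∙ e)ᗮ => (z : E)) 0 :=
    (ℝ ∙ e)ᗮ.subtypeL.contDiff.contDiffAt
  have h2 : ContDiffAt ℝ 1 (fun z : (ℝ ∙ e)ᗮ => 1 - ‖z‖ ^ 2) 0 :=
    contDiffAt_const.sub (contDiff_norm_sq ℝ).contDiffAt
  exact h1.add ((h2.sqrt (by simp)).smul contDiffAt_const)

lemma halfSphereMap_zero (e : E) : halfSphereMap e 0 = e := by
  simp [halfSphereMap]

lemma norm_halfSphereMap {e : E} (he : ‖e‖ = 1) {z : (ℝ ∙ e)ᗮ} (hz : ‖z‖ ≤ 1) :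
    ‖halfSphereMap e z‖ = 1 := by
  have h0 : ⟪(z : E), √(1 - ‖z‖ ^ 2) • e⟫ = 0 := by
    rw [inner_smul_right, Submodule.mem_orthogonal_singleton_iff_inner_left.mp z.2, mul_zero]
  have h1 : ‖halfSphereMap e z‖ ^ 2 = 1 := by
    have h2 : 0 ≤ 1 - ‖z‖ ^ 2 := by nlinarith [norm_nonneg z]
    rw [halfSphereMap, norm_add_sq_real, h0, norm_smul, he, mul_one, Real.norm_eq_abs, sq_abs,
      Real.sq_sqrt h2, Submodule.coe_norm]
    ring
  nlinarith [norm_nonneg (halfSphereMap e z)]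

lemma orthogonalProjection_halfSphereMap (e : E) (z : (ℝ ∙ e)ᗮ) :
    (ℝ ∙ e)ᗮ.orthogonalProjectionOnto (halfSphereMap e z) = z := by
  have h : (ℝ ∙ e)ᗮ.orthogonalProjectionOnto e = 0 :=
    Submodule.orthogonalProjectionOnto_orthogonal_apply_eq_zero (Submodule.mem_span_singleton_self e)
  rw [halfSphereMap, map_add, map_smul, h, smul_zero, add_zero,
    Submodule.orthogonalProjectionOnto_mem_subspace_eq_self]

lemma norm_sq_orthogonalProjection_orthogonal_unit {e : E} (he : ‖e‖ = 1) (u : E) :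
    ‖(ℝ ∙ e)ᗮ.orthogonalProjectionOnto u‖ ^ 2 = ‖u‖ ^ 2 - ⟪u, e⟫ ^ 2 := by
  have h := Submodule.norm_sq_eq_add_norm_sq_projection u (ℝ ∙ e)
  have h1 : ‖(ℝ ∙ e).orthogonalProjectionOnto u‖ ^ 2 = ⟪u, e⟫ ^ 2 := by
    rw [← Submodule.norm_coe, ← Submodule.starProjection_apply,
      Submodule.starProjection_unit_singleton ℝ he, norm_smul, he, mul_one, Real.norm_eq_abs,
      sq_abs, real_inner_comm]
  linarith

lemma halfSphereMap_orthogonalProjection {e u : E} (he : ‖e‖ = 1) (hu : ‖u‖ = 1)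
    (hpos : 0 ≤ ⟪u, e⟫) :
    halfSphereMap e ((ℝ ∙ e)ᗮ.orthogonalProjectionOnto u) = u := by
  rw [halfSphereMap, norm_sq_orthogonalProjection_orthogonal_unit he, hu]
  have h1 : √(1 - ((1 : ℝ) ^ 2 - ⟪u, e⟫ ^ 2)) = ⟪u, e⟫ := by
    rw [show 1 - ((1 : ℝ) ^ 2 - ⟪u, e⟫ ^ 2) = ⟪u, e⟫ ^ 2 by ring, Real.sqrt_sq hpos]
  rw [h1, ← Submodule.starProjection_apply, Submodule.starProjection_orthogonal_val,
    Submodule.starProjection_unit_singleton ℝ he, real_inner_comm]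
  simp

variable [FiniteDimensional ℝ E]

lemma cast_finrank_orthogonal_unit {e : E} (he : ‖e‖ = 1) :
    (finrank ℝ (ℝ ∙ e)ᗮ : ℝ) = (finrank ℝ E : ℝ) - 1 := by
  have h := Submodule.finrank_add_finrank_orthogonal (ℝ ∙ e)
  have h0 : e ≠ 0 := by
    rintro rfl
    simp at he
  rw [finrank_span_singleton h0] at h
  rw [← h]
  push_cast
  ring

variable [MeasurableSpace E] [BorelSpace E]

lemma hausdorffMeasure_sphere_inter_pos {U : Set E} (hU : IsOpen U)
    (hne : (U ∩ sphere 0 1).Nonempty) :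
    0 < μH[(finrank ℝ E : ℝ) - 1] (U ∩ sphere (0 : E) 1) := by
  obtain ⟨e, heU, he⟩ := hne
  rw [mem_sphere_zero_iff_norm] at he
  rw [← cast_finrank_orthogonal_unit he]
  let W : Set (ℝ ∙ e)ᗮ := halfSphereMap e ⁻¹' U ∩ ball 0 1
  have hW : IsOpen W := (hU.preimage (continuous_halfSphereMap e)).inter isOpen_ball
  have hWne : W.Nonempty :=
    ⟨0, by simpa only [mem_preimage, halfSphereMap_zero] using heU, mem_ball_self one_pos⟩
  have hsub : W ⊆ (ℝ ∙ e)ᗮ.orthogonalProjectionOnto '' (U ∩ sphere (0 : E) 1) := by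
    rintro z ⟨hz, hz1⟩
    refine ⟨halfSphereMap e z, ⟨hz, ?_⟩, orthogonalProjection_halfSphereMap e z⟩
    rw [mem_sphere_zero_iff_norm]
    exact norm_halfSphereMap he (mem_ball_zero_iff.mp hz1).le
  have hlip : LipschitzWith 1 ((ℝ ∙ e)ᗮ.orthogonalProjectionOnto : E → (ℝ ∙ e)ᗮ) :=
    Submodule.lipschitzWith_orthogonalProjectionOnto _
  have h1 := hlip.hausdorffMeasure_image_le (Nat.cast_nonneg (finrank ℝ (ℝ ∙ e)ᗮ))
    (U ∩ sphere (0 : E) 1)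
  rw [ENNReal.coe_one, ENNReal.one_rpow, one_mul] at h1
  exact (hW.measure_pos _ hWne).trans_le ((measure_mono hsub).trans h1)

variable (E) in
lemma hausdorffMeasure_sphere_lt_top :
    μH[(finrank ℝ E : ℝ) - 1] (sphere (0 : E) 1) < ∞ := by
  have : ProperSpace E := FiniteDimensional.proper ℝ E
  refine (isCompact_sphere (0 : E) 1).measure_lt_top_of_nhdsWithin fun e he => ?_
  rw [mem_sphere_zero_iff_norm] at he
  rw [← cast_finrank_orthogonal_unit he]
  obtain ⟨C, t, ht, hlip⟩ := (contDiffAt_halfSphereMap e).exists_lipschitzOnWith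
  have hcont : Continuous ((ℝ ∙ e)ᗮ.orthogonalProjectionOnto : E → (ℝ ∙ e)ᗮ) :=
    (ℝ ∙ e)ᗮ.orthogonalProjectionOnto.continuous
  have h0 : (ℝ ∙ e)ᗮ.orthogonalProjectionOnto e = 0 :=
    Submodule.orthogonalProjectionOnto_orthogonal_apply_eq_zero (Submodule.mem_span_singleton_self e)
  have hN : {u : E | (ℝ ∙ e)ᗮ.orthogonalProjectionOnto u ∈ t ∩ ball 0 1 ∧ 0 < ⟪u, e⟫} ∈
      nhds e := by
    refine Filter.inter_mem (hcont.continuousAt.preimage_mem_nhds ?_) ?_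
    · rw [h0]
      exact Filter.inter_mem ht (ball_mem_nhds 0 one_pos)
    · have hopen : IsOpen {u : E | 0 < ⟪u, e⟫} := isOpen_lt continuous_const (by fun_prop)
      refine hopen.mem_nhds ?_
      rw [mem_ofPred_eq, real_inner_self_eq_norm_sq, he]
      norm_num
  refine ⟨_, inter_mem_nhdsWithin _ hN, ?_⟩
  have hsub : sphere (0 : E) 1 ∩
      {u : E | (ℝ ∙ e)ᗮ.orthogonalProjectionOnto u ∈ t ∩ ball 0 1 ∧ 0 < ⟪u, e⟫} ⊆
      halfSphereMap e '' (t ∩ ball 0 1) := by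
    rintro u ⟨hu, hut, hpos⟩
    rw [mem_sphere_zero_iff_norm] at hu
    exact ⟨_, hut, halfSphereMap_orthogonalProjection he hu hpos.le⟩
  refine (measure_mono hsub).trans_lt ?_
  refine ((hlip.mono inter_subset_left).hausdorffMeasure_image_le
    (Nat.cast_nonneg (finrank ℝ (ℝ ∙ e)ᗮ))).trans_lt ?_
  refine ENNReal.mul_lt_top ?_ ?_
  · rw [ENNReal.rpow_natCast]
    exact ENNReal.pow_lt_top ENNReal.coe_lt_top
  · exact (measure_mono inter_subset_right).trans_lt measure_ball_lt_top

end Sphere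

section Sections

variable {E : Type*} [NormedAddCommGroup E] [InnerProductSpace ℝ E]

lemma zero_mem_interior_of_symmetric {K : Set E} (hconv : Convex ℝ K)
    (hne : (interior K).Nonempty) (hsym : K = -K) : (0 : E) ∈ interior K := by
  obtain ⟨x, hx⟩ := hne
  have hx' : -x ∈ interior K := by
    have h : x ∈ interior (-K) := hsym ▸ hx
    have h' : x ∈ Homeomorph.neg E ⁻¹' interior K := by
      rw [(Homeomorph.neg E).preimage_interior]
      exact h
    exact h'
  have h := hconv.interior hx hx' (a := 1 / 2) (b := 1 / 2) (by norm_num) (by norm_num)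
    (by norm_num)
  simpa using h

variable [FiniteDimensional ℝ E]

/-- The central section of `K` by `(g e)ᗮ`, pulled back to `eᗮ` by the rotation `g`. -/
def rotSection (K : Set E) (e : E) (g : OrthGroup E) : Set (ℝ ∙ e)ᗮ :=
  {z | g.1 (z : E) ∈ K}

lemma mem_rotSection {K : Set E} {e : E} {g : OrthGroup E} {z : (ℝ ∙ e)ᗮ} :
    z ∈ rotSection K e g ↔ g.1 (z : E) ∈ K :=
  Iff.rfl

lemma rotSection_closedBall (e : E) (g : OrthGroup E) (r : ℝ) :
    rotSection (closedBall 0 r) e g = closedBall 0 r := by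
  ext z
  rw [mem_rotSection, mem_closedBall_zero_iff, mem_closedBall_zero_iff, g.norm_apply,
    Submodule.coe_norm]

lemma isClosed_rotSection {K : Set E} (hK : IsClosed K) (e : E) (g : OrthGroup E) :
    IsClosed (rotSection K e g) :=
  hK.preimage (g.1.continuous.comp continuous_subtype_val)

lemma convex_rotSection {K : Set E} (hK : Convex ℝ K) (e : E) (g : OrthGroup E) :
    Convex ℝ (rotSection K e g) :=
  hK.linear_preimage (g.1.toLinearMap ∘ₗ (ℝ ∙ e)ᗮ.subtype)

lemma apply_mem_interior_of_mem_interior_rotSection {K : Set E} (hconv : Convex ℝ K)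
    (h0 : (0 : E) ∈ interior K) {e : E} {g : OrthGroup E} {z : (ℝ ∙ e)ᗮ}
    (hz : z ∈ interior (rotSection K e g)) : g.1 (z : E) ∈ interior K := by
  have hev : ∀ᶠ t : ℝ in nhds 1, t • z ∈ interior (rotSection K e g) := by
    have hc : Continuous fun t : ℝ => t • z := by fun_prop
    refine hc.continuousAt.eventually_mem (isOpen_interior.mem_nhds ?_)
    rwa [one_smul]
  obtain ⟨t, ht, ht1⟩ :=
    ((hev.filter_mono nhdsWithin_le_nhds).and (self_mem_nhdsWithin (s := Ioi 1))).exists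
  have ht1' : 1 < t := ht1
  have htK : g.1 ((t • z : (ℝ ∙ e)ᗮ) : E) ∈ K :=
    mem_rotSection.mp (interior_subset ht)
  have h := hconv.combo_interior_self_mem_interior h0 htK (a := 1 - t⁻¹) (b := t⁻¹)
    (by linarith [inv_lt_one_of_one_lt₀ ht1']) (by positivity) (by ring)
  rwa [Submodule.coe_smul, map_smul, smul_smul, inv_mul_cancel₀ (by positivity), one_smul,
    smul_zero, zero_add] at h

variable [MeasurableSpace E] [BorelSpace E]

/-- The Hausdorff measure of top dimension on the hyperplane `eᗮ`. -/
abbrev perpMeasure (e : E) : Measure (ℝ ∙ e)ᗮ := μH[finrank ℝ (ℝ ∙ e)ᗮ]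

lemma measure_rotSection_lt_top {K : Set E} (hcomp : IsCompact K) (e : E) (g : OrthGroup E) :
    perpMeasure e (rotSection K e g) < ∞ := by
  obtain ⟨R, hR⟩ := hcomp.isBounded.subset_closedBall 0
  refine (measure_mono (t := closedBall 0 R) ?_).trans_lt measure_closedBall_lt_top
  rw [← rotSection_closedBall e g R]
  exact preimage_mono hR

lemma continuous_measure_rotSection {K : Set E} (hconv : Convex ℝ K) (hcomp : IsCompact K)
    (h0 : (0 : E) ∈ interior K) (e : E) :
    Continuous fun g : OrthGroup E => perpMeasure e (rotSection K e g) := by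
  obtain ⟨R, hR⟩ := hcomp.isBounded.subset_closedBall 0
  have hint : ∀ g : OrthGroup E, perpMeasure e (rotSection K e g) =
      ENNReal.ofReal (∫ z, (rotSection K e g).indicator (fun _ => (1 : ℝ)) z ∂perpMeasure e) := by
    intro g
    rw [integral_indicator_const _ (isClosed_rotSection hcomp.isClosed e g).measurableSet,
      smul_eq_mul, mul_one, Measure.real,
      ENNReal.ofReal_toReal (measure_rotSection_lt_top hcomp e g).ne]
  simp_rw [hint]
  refine ENNReal.continuous_ofReal.comp (continuous_iff_continuousAt.mpr fun g => ?_)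
  refine continuousAt_of_dominated
    (bound := (closedBall (0 : (ℝ ∙ e)ᗮ) R).indicator fun _ => (1 : ℝ)) ?_ ?_ ?_ ?_
  · refine Filter.Eventually.of_forall fun g' => ?_
    exact (stronglyMeasurable_const.indicator
      (isClosed_rotSection hcomp.isClosed e g').measurableSet).aestronglyMeasurable
  · refine Filter.Eventually.of_forall fun g' => Filter.Eventually.of_forall fun z => ?_
    rw [norm_indicator_eq_indicator_norm, norm_one, ← rotSection_closedBall e g' R]
    exact indicator_le_indicator_of_subset (preimage_mono hR) (fun _ => zero_le_one) z
  · exact (integrable_indicator_iff isClosed_closedBall.measurableSet).mpr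
      (integrableOn_const measure_closedBall_lt_top.ne)
  · have hfr : ∀ᵐ z ∂perpMeasure e, z ∉ frontier (rotSection K e g) :=
      measure_eq_zero_iff_ae_notMem.mp ((convex_rotSection hconv e g).addHaar_frontier _)
    filter_upwards [hfr] with z hz
    have hcont : Continuous fun g' : OrthGroup E => g'.1 (z : E) :=
      OrthGroup.continuous_apply_const _
    by_cases hzK : z ∈ rotSection K e g
    · have hzi : z ∈ interior (rotSection K e g) := by
        by_contra hcon
        exact hz ⟨subset_closure hzK, hcon⟩
      have hev : ∀ᶠ g' : OrthGroup E in nhds g, g'.1 (z : E) ∈ interior K :=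
        hcont.continuousAt.eventually_mem (isOpen_interior.mem_nhds
          (apply_mem_interior_of_mem_interior_rotSection hconv h0 hzi))
      refine continuousAt_const (y := (1 : ℝ)) |>.congr ?_
      filter_upwards [hev] with g' hg'
      rw [indicator_of_mem (mem_rotSection.mpr (interior_subset hg'))]
    · have hev : ∀ᶠ g' : OrthGroup E in nhds g, g'.1 (z : E) ∈ Kᶜ :=
        hcont.continuousAt.eventually_mem (hcomp.isClosed.isOpen_compl.mem_nhds hzK)
      refine continuousAt_const (y := (0 : ℝ)) |>.congr ?_
      filter_upwards [hev] with g' hg'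
      rw [indicator_of_notMem (mt mem_rotSection.mp hg')]

end Sections

section Distribution

variable {n : ℕ}

lemma sectionVol_apply (K : Set (Euc n)) {e : Euc n} (he : ‖e‖ = 1) (g : OrthGroup (Euc n)) :
    sectionVol n K (g.1 e) = perpMeasure e (rotSection K e g) := by
  have hset : K ∩ {x : Euc n | ⟪x, g.1 e⟫ = 0} =
      (fun z : (ℝ ∙ e)ᗮ => g.1 (z : Euc n)) '' rotSection K e g := by
    ext x
    constructor
    · rintro ⟨hxK, hx⟩
      have hx' : ⟪x, g.1 e⟫ = 0 := hx
      refine ⟨⟨(g⁻¹).1 x, ?_⟩, ?_, g.apply_inv_apply x⟩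
      · rw [Submodule.mem_orthogonal_singleton_iff_inner_left, ← g.inner_apply,
          g.apply_inv_apply, hx']
      · rwa [mem_rotSection, g.apply_inv_apply]
    · rintro ⟨z, hz, rfl⟩
      refine ⟨hz, ?_⟩
      change ⟪g.1 (z : Euc n), g.1 e⟫ = 0
      rw [g.inner_apply, Submodule.mem_orthogonal_singleton_iff_inner_left.mp z.2]
  have hiso : Isometry fun z : (ℝ ∙ e)ᗮ => g.1 (z : Euc n) :=
    g.isometry.comp isometry_subtype_coe
  have hdim := cast_finrank_orthogonal_unit he
  rw [finrank_euclideanSpace_fin] at hdim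
  rw [sectionVol, hset, ← hdim, hiso.hausdorffMeasure_image (Or.inl (Nat.cast_nonneg _))]

lemma hausdorffMeasure_sphere_lt_top' (n : ℕ) :
    μH[(n : ℝ) - 1] (sphere (0 : Euc n) 1) < ∞ := by
  have h := hausdorffMeasure_sphere_lt_top (Euc n)
  rwa [finrank_euclideanSpace_fin] at h

lemma hausdorffMeasure_sphere_inter_pos' {U : Set (Euc n)} (hU : IsOpen U)
    (hne : (U ∩ sphere 0 1).Nonempty) :
    0 < μH[(n : ℝ) - 1] (U ∩ sphere (0 : Euc n) 1) := by
  have h := hausdorffMeasure_sphere_inter_pos hU hne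
  rwa [finrank_euclideanSpace_fin] at h

/-- A continuous function on the orthogonal group factoring through the sphere has closed
preimages in the sphere. -/
lemma isClosed_image_orbit {α : Type*} [TopologicalSpace α] {F : OrthGroup (Euc n) → α}
    (hF : Continuous F) {s : Set α} (hs : IsClosed s) (e : Euc n) :
    IsClosed ((fun g : OrthGroup (Euc n) => g.1 e) '' (F ⁻¹' s)) :=
  ((hs.preimage hF).isCompact.image (OrthGroup.continuous_apply_const e)).isClosed

lemma sphHaar_eq_one_iff {A : Set (Euc n)} (hA : IsClosed A) (e : Euc n) (he : ‖e‖ = 1) :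
    sphHaar n A = 1 ↔ sphere 0 1 ⊆ A := by
  have hS : (univ ∩ sphere (0 : Euc n) 1).Nonempty :=
    ⟨e, mem_univ _, mem_sphere_zero_iff_norm.mpr he⟩
  have hpos := hausdorffMeasure_sphere_inter_pos' isOpen_univ hS
  rw [univ_inter] at hpos
  have hfin := hausdorffMeasure_sphere_lt_top' n
  rw [sphHaar, ENNReal.div_eq_one_iff hpos.ne' hfin.ne]
  constructor
  · intro h x hx
    by_contra hxA
    have h1 := hausdorffMeasure_sphere_inter_pos' hA.isOpen_compl ⟨x, hxA, hx⟩
    have h2 := measure_inter_add_sdiff (μ := μH[(n : ℝ) - 1]) (sphere (0 : Euc n) 1)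
      hA.measurableSet
    rw [inter_comm, h, sdiff_eq, inter_comm] at h2
    refine h1.ne' ?_
    have h3 := h2.trans (add_zero _).symm
    exact (ENNReal.add_right_inj hfin.ne).mp h3
  · intro h
    rw [inter_eq_self_of_subset_right h]

/-- If the section function of `K` has the distribution of that of a ball, then all central
sections of `K` have the same measure as those of the ball. -/
lemma measure_rotSection_eq_of_Sdist_eq {K : Set (Euc n)} (hconv : Convex ℝ K)
    (hcomp : IsCompact K) (h0 : (0 : Euc n) ∈ interior K) {r : ℝ}
    (h : ∀ t : ℝ, 0 ≤ t → Sdist n K t = Sdist n (closedBall (0 : Euc n) r) t)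
    {e : Euc n} (he : ‖e‖ = 1) (g : OrthGroup (Euc n)) :
    perpMeasure e (rotSection K e g) = perpMeasure e (closedBall 0 r) := by
  have hF := continuous_measure_rotSection hconv hcomp h0 e
  have hcfin : perpMeasure e (closedBall 0 r) < ∞ := measure_closedBall_lt_top
  have hball : ∀ k : OrthGroup (Euc n),
      sectionVol n (closedBall 0 r) (k.1 e) = perpMeasure e (closedBall 0 r) := fun k => by
    rw [sectionVol_apply _ he, rotSection_closedBall]
  have horbit : ∀ u ∈ sphere (0 : Euc n) 1, ∃ k : OrthGroup (Euc n), k.1 e = u := fun u hu =>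
    OrthGroup.exists_apply_eq (he.trans (mem_sphere_zero_iff_norm.mp hu).symm)
  have hsphere : ∀ k : OrthGroup (Euc n), k.1 e ∈ sphere (0 : Euc n) 1 := fun k => by
    rw [mem_sphere_zero_iff_norm, k.norm_apply, he]
  refine le_antisymm ?_ ?_
  · by_contra! hlt
    obtain ⟨t, hct, htg⟩ := ENNReal.lt_iff_exists_nnreal_btwn.mp hlt
    have hS := h t t.2
    have hz : Sdist n (closedBall (0 : Euc n) r) t = 0 := by
      have hempty : {θ : Euc n | ENNReal.ofReal t ≤ sectionVol n (closedBall 0 r) θ} ∩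
          sphere 0 1 = ∅ := by
        refine eq_empty_of_forall_notMem ?_
        rintro u ⟨hu, hu1⟩
        obtain ⟨k, rfl⟩ := horbit u hu1
        have hu' : ENNReal.ofReal t ≤ sectionVol n (closedBall 0 r) (k.1 e) := hu
        rw [hball, ENNReal.ofReal_coe_nnreal] at hu'
        exact hct.not_ge hu'
      rw [Sdist, sphHaar, hempty, measure_empty, ENNReal.zero_div]
    rw [hz, Sdist, sphHaar, ENNReal.div_eq_zero_iff] at hS
    have hS' := hS.resolve_right (hausdorffMeasure_sphere_lt_top' n).ne
    have hcl := isClosed_image_orbit hF (isClosed_Iic (a := (t : ℝ≥0∞))) e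
    refine (hausdorffMeasure_sphere_inter_pos' hcl.isOpen_compl
      ⟨g.1 e, ?_, hsphere g⟩).ne' (measure_mono_null ?_ hS')
    · rintro ⟨k, hk, hkg⟩
      have hk' : perpMeasure e (rotSection K e k) ≤ t := hk
      have hkg' : k.1 e = g.1 e := hkg
      rw [← sectionVol_apply K he, hkg', sectionVol_apply K he] at hk'
      exact htg.not_ge hk'
    · rintro u ⟨hu, hu1⟩
      obtain ⟨k, rfl⟩ := horbit u hu1
      refine ⟨?_, hu1⟩
      change ENNReal.ofReal t ≤ sectionVol n K (k.1 e)
      rw [sectionVol_apply K he, ENNReal.ofReal_coe_nnreal]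
      by_contra! hcon
      exact hu ⟨k, hcon.le, rfl⟩
  · let c : ℝ := (perpMeasure e (closedBall 0 r)).toReal
    have hc : ENNReal.ofReal c = perpMeasure e (closedBall 0 r) := ENNReal.ofReal_toReal hcfin.ne
    have hA := isClosed_image_orbit hF (isClosed_Ici (a := ENNReal.ofReal c)) e
    have hSK : ∀ L : Set (Euc n), Sdist n L c =
        sphHaar n ((fun k : OrthGroup (Euc n) => k.1 e) ''
          ((fun k => perpMeasure e (rotSection L e k)) ⁻¹' Ici (ENNReal.ofReal c))) := by
      intro L
      rw [Sdist, sphHaar, sphHaar]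
      congr 2
      ext u
      constructor
      · rintro ⟨hu, hu1⟩
        obtain ⟨k, rfl⟩ := horbit u hu1
        have hu' : ENNReal.ofReal c ≤ sectionVol n L (k.1 e) := hu
        rw [sectionVol_apply L he] at hu'
        exact ⟨⟨k, hu', rfl⟩, hu1⟩
      · rintro ⟨⟨k, hk, rfl⟩, hu1⟩
        refine ⟨?_, hu1⟩
        change ENNReal.ofReal c ≤ sectionVol n L (k.1 e)
        rw [sectionVol_apply L he]
        exact hk
    have hone : Sdist n (closedBall (0 : Euc n) r) c = 1 := by
      have hset : (fun k : OrthGroup (Euc n) => perpMeasure e (rotSection (closedBall 0 r) e k)) ⁻¹'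
          Ici (ENNReal.ofReal c) = univ := by
        refine eq_univ_of_forall fun k => ?_
        change ENNReal.ofReal c ≤ perpMeasure e (rotSection (closedBall 0 r) e k)
        rw [rotSection_closedBall, hc]
      rw [hSK, hset, sphHaar_eq_one_iff _ e he]
      · intro u hu
        obtain ⟨k, rfl⟩ := horbit u hu
        exact ⟨k, mem_univ _, rfl⟩
      · exact (isCompact_univ.image (OrthGroup.continuous_apply_const e)).isClosed
    rw [← h c ENNReal.toReal_nonneg, hSK, sphHaar_eq_one_iff hA e he] at hone
    obtain ⟨k, hk, hkg⟩ := hone (hsphere g)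
    have hk' : ENNReal.ofReal c ≤ perpMeasure e (rotSection K e k) := hk
    have hkg' : k.1 e = g.1 e := hkg
    rwa [← sectionVol_apply K he, hkg', sectionVol_apply K he, hc] at hk'

end Distribution

section Funk

lemma exists_eq_norm_smul_unit {V : Type*} [NormedAddCommGroup V] [NormedSpace ℝ V]
    [Nontrivial V] (w : V) : ∃ w₀ : V, ‖w₀‖ = 1 ∧ w = ‖w‖ • w₀ := by
  by_cases hw : w = 0
  · obtain ⟨w₀, hw₀⟩ := exists_norm_eq V zero_le_one
    exact ⟨w₀, hw₀, by simp [hw]⟩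
  · exact ⟨‖w‖⁻¹ • w, norm_smul_inv_norm (𝕜 := ℝ) hw, by
      rw [smul_smul, mul_inv_cancel₀ (norm_ne_zero_iff.mpr hw), one_smul]⟩

/-- Even moments of the unit ball with respect to linear functionals. -/
lemma exists_ball_moment (V : Type*) [NormedAddCommGroup V] [InnerProductSpace ℝ V]
    [FiniteDimensional ℝ V] [Nontrivial V] [MeasurableSpace V] [BorelSpace V] (m : ℕ) :
    ∃ C : ℝ, 0 < C ∧ ∀ u : V,
      ∫ w in closedBall (0 : V) 1, ⟪w, u⟫ ^ (2 * m) ∂μH[finrank ℝ V] = C * (‖u‖ ^ 2) ^ m := by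
  obtain ⟨u₀, hu₀⟩ := exists_norm_eq V zero_le_one
  have hcont : ∀ u : V, Continuous fun w : V => ⟪w, u⟫ ^ (2 * m) := fun u => by fun_prop
  refine ⟨∫ w in closedBall (0 : V) 1, ⟪w, u₀⟫ ^ (2 * m) ∂μH[finrank ℝ V], ?_, fun u => ?_⟩
  · have : ProperSpace V := FiniteDimensional.proper ℝ V
    rw [setIntegral_pos_iff_support_of_nonneg_ae]
    · have hopen : IsOpen ((fun w : V => ⟪w, u₀⟫ ^ (2 * m)).support ∩ ball 0 1) :=
        (hcont u₀).isOpen_support.inter isOpen_ball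
      refine (hopen.measure_pos μH[finrank ℝ V] ⟨(1 / 2 : ℝ) • u₀, ?_, ?_⟩).trans_le
        (measure_mono (inter_subset_inter_right _ ball_subset_closedBall))
      · rw [Function.mem_support, real_inner_smul_left, real_inner_self_eq_norm_sq, hu₀]
        positivity
      · rw [mem_ball_zero_iff, norm_smul, hu₀]
        norm_num
    · refine Filter.Eventually.of_forall fun w => ?_
      exact (even_two_mul m).pow_nonneg _
    · exact (hcont u₀).continuousOn.integrableOn_compact (isCompact_closedBall _ _)
  · obtain ⟨u₁, hu₁, hu⟩ := exists_eq_norm_smul_unit u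
    obtain ⟨f, hf⟩ : ∃ f : V ≃ₗᵢ[ℝ] V, f u₀ = u₁ :=
      ⟨_, Submodule.reflection_sub (hu₀.trans hu₁.symm)⟩
    have hmp : MeasurePreserving f μH[finrank ℝ V] μH[finrank ℝ V] :=
      f.toIsometryEquiv.measurePreserving_hausdorffMeasure _
    have hrot := hmp.setIntegral_preimage_emb f.toHomeomorph.measurableEmbedding
      (fun w => ⟪w, u₁⟫ ^ (2 * m)) (closedBall 0 1)
    have hpre : f ⁻¹' closedBall 0 1 = closedBall 0 1 := by
      rw [f.preimage_closedBall, map_zero]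
    have hin : ∀ w, ⟪f w, u₁⟫ = ⟪w, u₀⟫ := fun w => by rw [← hf, f.inner_map_map]
    simp_rw [hpre, hin] at hrot
    have hscale : ∀ w, ⟪w, u⟫ ^ (2 * m) = (‖u‖ ^ 2) ^ m * ⟪w, u₁⟫ ^ (2 * m) := fun w => by
      rw [← pow_mul, ← mul_pow, ← real_inner_smul_right, ← hu]
    simp_rw [hscale]
    rw [integral_const_mul, ← hrot, mul_comm]

lemma integrable_restrict_prod_of_bounded {X Y : Type*} [MeasurableSpace X] [MeasurableSpace Y]
    {μ : Measure X} {ν : Measure Y} [SFinite μ] [IsFiniteMeasure ν] {s : Set X}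
    (hs : MeasurableSet s) (hμs : μ s ≠ ∞) {F : X → Y → ℝ}
    (hF : Measurable (Function.uncurry F)) {C : ℝ} (hC : ∀ x ∈ s, ∀ y, ‖F x y‖ ≤ C) :
    Integrable (Function.uncurry F) ((μ.restrict s).prod ν) := by
  have : IsFiniteMeasure (μ.restrict s) := isFiniteMeasure_restrict.mpr hμs
  refine Integrable.of_bound hF.aestronglyMeasurable C ?_
  have h := Measure.prod_restrict (μ := μ) (ν := ν) s univ
  rw [Measure.restrict_univ] at h
  rw [h]
  filter_upwards [ae_restrict_mem (hs.prod MeasurableSet.univ)] with p hp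
  exact hC p.1 hp.1 p.2

lemma integral_pow_mul_eq_zero_of_one_sub {X : Type*} [MeasurableSpace X] {ν : Measure X}
    {q f : X → ℝ} (hint : ∀ m : ℕ, Integrable (fun x => (1 - q x) ^ m * f x) ν)
    (h : ∀ m : ℕ, ∫ x, (1 - q x) ^ m * f x ∂ν = 0) (M : ℕ) :
    ∫ x, q x ^ M * f x ∂ν = 0 := by
  have hexp : ∀ x, q x ^ M * f x = ∑ m ∈ Finset.range (M + 1),
      ((-1) ^ m * (M.choose m : ℝ)) * ((1 - q x) ^ m * f x) := by
    intro x
    have hq : q x = -(1 - q x) + 1 := by ring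
    conv_lhs => rw [hq, add_pow, Finset.sum_mul]
    refine Finset.sum_congr rfl fun m _ => ?_
    rw [neg_pow, one_pow]
    ring
  simp_rw [hexp]
  rw [integral_finsetSum _ fun m _ => (hint m).const_mul _]
  refine Finset.sum_eq_zero fun m _ => ?_
  rw [integral_const_mul, h, mul_zero]

/-- High powers of `q` concentrate where `q` is largest, so a function that is bounded below and
uniformly positive there has a positive moment. -/
lemma exists_integral_pow_mul_pos {X : Type*} [MeasurableSpace X] {ν : Measure X}
    [IsFiniteMeasure ν] {q f : X → ℝ} (hq : Measurable q) (hq0 : ∀ x, 0 ≤ q x)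
    (hq1 : ∀ x, q x ≤ 1) (hf : Integrable f ν) {a b c δ : ℝ} (ha : 0 ≤ a) (hab : a < b)
    (hc : 0 ≤ c) (hδ : 0 < δ) (hfc : ∀ x, -c ≤ f x) (hfδ : ∀ x, a < q x → δ ≤ f x)
    (hpos : ν {x | b < q x} ≠ 0) :
    ∃ M : ℕ, 0 < ∫ x, q x ^ M * f x ∂ν := by
  have hb : 0 < b := ha.trans_lt hab
  have hT : MeasurableSet {x | b < q x} := measurableSet_lt measurable_const hq
  let p : ℝ := ν.real {x | b < q x}
  have hp : 0 < p := ENNReal.toReal_pos hpos (measure_ne_top _ _)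
  let N : ℝ := ν.real univ
  have hN : 0 ≤ N := measureReal_nonneg
  obtain ⟨M, hM⟩ := exists_pow_lt_of_lt_one (show 0 < δ * p / (c * N + 1) by positivity)
    ((div_lt_one hb).mpr hab)
  refine ⟨M, ?_⟩
  have hlow : ∀ x, {x | b < q x}.indicator (fun _ => δ * b ^ M) x - c * a ^ M ≤
      q x ^ M * f x := by
    intro x
    by_cases hxa : a < q x
    · have h1 : {x | b < q x}.indicator (fun _ => δ * b ^ M) x ≤ q x ^ M * f x := by
        by_cases hxb : b < q x
        · rw [indicator_of_mem (show x ∈ {x | b < q x} from hxb), mul_comm]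
          exact mul_le_mul (pow_le_pow_left₀ hb.le hxb.le M) (hfδ x hxa) hδ.le
            (pow_nonneg (hq0 x) M)
        · rw [indicator_of_notMem (show x ∉ {x | b < q x} from hxb)]
          exact mul_nonneg (pow_nonneg (hq0 x) M) (hδ.le.trans (hfδ x hxa))
      have h2 : 0 ≤ c * a ^ M := by positivity
      linarith
    · have hxb : x ∉ {x | b < q x} := fun h => hxa (hab.trans h)
      rw [indicator_of_notMem hxb]
      have h1 : q x ^ M ≤ a ^ M := pow_le_pow_left₀ (hq0 x) (not_lt.mp hxa) M
      have h2 : q x ^ M * (-c) ≤ q x ^ M * f x :=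
        mul_le_mul_of_nonneg_left (hfc x) (pow_nonneg (hq0 x) M)
      nlinarith
  have hint1 : Integrable ({x | b < q x}.indicator fun _ => δ * b ^ M) ν :=
    (integrable_const _).indicator hT
  have hint2 : Integrable (fun x => q x ^ M * f x) ν := by
    refine hf.bdd_mul (c := 1) (hq.pow_const M).aestronglyMeasurable
      (Filter.Eventually.of_forall fun x => ?_)
    rw [norm_pow, Real.norm_of_nonneg (hq0 x)]
    exact pow_le_one₀ (hq0 x) (hq1 x)
  have hle : ∫ x, ({x | b < q x}.indicator (fun _ => δ * b ^ M) x - c * a ^ M) ∂ν ≤ _ :=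
    integral_mono (hint1.sub (integrable_const (c * a ^ M))) hint2 hlow
  have hval : ∫ x, ({x | b < q x}.indicator (fun _ => δ * b ^ M) x - c * a ^ M) ∂ν =
      p * (δ * b ^ M) - N * (c * a ^ M) := by
    rw [integral_sub hint1 (integrable_const _), integral_indicator_const _ hT, integral_const,
      smul_eq_mul, smul_eq_mul]
  rw [hval] at hle
  refine lt_of_lt_of_le ?_ hle
  rw [div_pow, div_lt_div_iff₀ (by positivity) (by positivity)] at hM
  have haM : 0 ≤ a ^ M := by positivity
  nlinarith

variable {E : Type*} [NormedAddCommGroup E] [InnerProductSpace ℝ E] [FiniteDimensional ℝ E]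

lemma abs_inner_orbit_le_one {e v : E} (he : ‖e‖ = 1) (hv : ‖v‖ = 1) (g : OrthGroup E) :
    |⟪g.1 e, v⟫| ≤ 1 := by
  have h := abs_real_inner_le_norm (g.1 e) v
  rwa [g.norm_apply, he, hv, one_mul] at h

lemma continuous_inner_apply (e v : E) :
    Continuous (Function.uncurry fun (w : (ℝ ∙ e)ᗮ) (g : OrthGroup E) => ⟪g.1 (w : E), v⟫) :=
  (OrthGroup.continuous_apply.comp
    (continuous_snd.prodMk (continuous_subtype_val.comp continuous_fst))).inner continuous_const

lemma continuous_inner_orbit (e v : E) : Continuous fun g : OrthGroup E => ⟪g.1 e, v⟫ :=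
  (OrthGroup.continuous_apply_const e).inner continuous_const

lemma norm_pow_mul_integral_orbit_eq {ν : Measure (OrthGroup E)} [ν.IsMulRightInvariant] {e : E} (he : ‖e‖ = 1) [Nontrivial (ℝ ∙ e)ᗮ] (v : E)
    (m : ℕ) (D : E → ℝ) (z w : (ℝ ∙ e)ᗮ) :
    ‖w‖ ^ (2 * m) * ∫ g : OrthGroup E, ⟪g.1 e, v⟫ ^ (2 * m) * D (g.1 (z : E)) ∂ν =
      ∫ g : OrthGroup E, ⟪g.1 (w : E), v⟫ ^ (2 * m) * D (‖z‖ • g.1 e) ∂ν := by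
  obtain ⟨w₀, hw₀, hw⟩ := exists_eq_norm_smul_unit w
  obtain ⟨k, hke, hkz⟩ := OrthGroup.exists_apply_eq_pair (x := e) (y := (z : E))
    (x' := (w₀ : E)) (y' := ‖z‖ • e) (by rw [he, ← hw₀, Submodule.coe_norm])
    (by rw [norm_smul, he, mul_one, norm_norm, Submodule.coe_norm])
    (Submodule.mem_orthogonal_singleton_iff_inner_right.mp z.2)
    (by rw [real_inner_smul_right, Submodule.mem_orthogonal_singleton_iff_inner_left.mp w₀.2,
      mul_zero])
  rw [← integral_mul_right_eq_self (μ := ν)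
    (fun g : OrthGroup E => ⟪g.1 e, v⟫ ^ (2 * m) * D (g.1 (z : E))) k, ← integral_const_mul]
  refine integral_congr_ae (Filter.Eventually.of_forall fun g => ?_)
  have h1 : (g * k).1 e = g.1 (w₀ : E) := by
    rw [← hke]
    rfl
  have h2 : (g * k).1 (z : E) = ‖z‖ • g.1 e := by
    rw [← map_smul, ← hkz]
    rfl
  have h3 : g.1 (w : E) = ‖w‖ • g.1 (w₀ : E) := by
    conv_lhs => rw [hw]
    rw [Submodule.coe_smul, map_smul]
  simp only [h1, h2, h3, real_inner_smul_left, mul_pow]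
  ring

variable [MeasurableSpace E] [BorelSpace E]

lemma measurable_comp_orbit {D : E → ℝ} (hD : Measurable D) (e : E) :
    Measurable (Function.uncurry fun (z : (ℝ ∙ e)ᗮ) (g : OrthGroup E) => D (‖z‖ • g.1 e)) := by
  refine hD.comp (Continuous.measurable ?_)
  exact continuous_fst.norm.smul ((OrthGroup.continuous_apply_const e).comp continuous_snd)

lemma measurable_comp_apply {D : E → ℝ} (hD : Measurable D) (e : E) :
    Measurable (Function.uncurry fun (z : (ℝ ∙ e)ᗮ) (g : OrthGroup E) => D (g.1 (z : E))) := by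
  refine hD.comp (Continuous.measurable ?_)
  exact OrthGroup.continuous_apply.comp
    (continuous_snd.prodMk (continuous_subtype_val.comp continuous_fst))

variable {ν : Measure (OrthGroup E)}

lemma integral_ball_inner_apply_pow {e v : E} (hv : ‖v‖ = 1) (he : ‖e‖ = 1) {m : ℕ} {C : ℝ}
    (hC : ∀ u : (ℝ ∙ e)ᗮ,
      ∫ w in closedBall (0 : (ℝ ∙ e)ᗮ) 1, ⟪w, u⟫ ^ (2 * m) ∂perpMeasure e = C * (‖u‖ ^ 2) ^ m)
    (g : OrthGroup E) :
    ∫ w in closedBall (0 : (ℝ ∙ e)ᗮ) 1, ⟪g.1 (w : E), v⟫ ^ (2 * m) ∂perpMeasure e =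
      C * (1 - ⟪g.1 e, v⟫ ^ 2) ^ m := by
  have hinner : ∀ x : E, ⟪g.1 x, v⟫ = ⟪x, (g⁻¹).1 v⟫ := fun x => by
    rw [← g.inner_apply x, g.apply_inv_apply]
  have hproj : ∀ w : (ℝ ∙ e)ᗮ, ⟪g.1 (w : E), v⟫ =
      ⟪w, (ℝ ∙ e)ᗮ.orthogonalProjectionOnto ((g⁻¹).1 v)⟫ := fun w => by
    rw [hinner, Submodule.inner_orthogonalProjectionOnto_eq_of_mem_left]
  simp_rw [hproj]
  rw [hC, norm_sq_orthogonalProjection_orthogonal_unit he, OrthGroup.norm_apply, hv, hinner,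
    real_inner_comm, one_pow]

/-- If a bounded function has vanishing integrals over all central discs of radius `R`, then the
radial integrals of the function are orthogonal to the powers of `1 - ⟪·, v⟫ ^ 2`. -/
lemma integral_radial_mul_one_sub_sq_pow_eq_zero {e v : E} (he : ‖e‖ = 1) (hv : ‖v‖ = 1)
    [Nontrivial (ℝ ∙ e)ᗮ] [IsFiniteMeasure ν] [ν.IsMulRightInvariant]
    {D : E → ℝ} (hD : Measurable D) (hD1 : ∀ x, ‖D x‖ ≤ 1) {R : ℝ}
    (hzero : ∀ g : OrthGroup E,
      ∫ z in closedBall (0 : (ℝ ∙ e)ᗮ) R, D (g.1 (z : E)) ∂perpMeasure e = 0) (m : ℕ) :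
    ∫ g : OrthGroup E, (1 - ⟪g.1 e, v⟫ ^ 2) ^ m *
      ∫ z in closedBall (0 : (ℝ ∙ e)ᗮ) R, D (‖z‖ • g.1 e) ∂perpMeasure e ∂ν = 0 := by
  obtain ⟨C, hCpos, hC⟩ := exists_ball_moment (ℝ ∙ e)ᗮ m
  have hfin : ∀ ρ : ℝ, perpMeasure e (closedBall 0 ρ) ≠ ∞ := fun ρ => measure_closedBall_lt_top.ne
  have hsq : ∀ g : OrthGroup E, ⟪g.1 e, v⟫ ^ 2 ≤ 1 := fun g =>
    (sq_le_one_iff_abs_le_one _).mpr (abs_inner_orbit_le_one he hv g)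
  let J : (ℝ ∙ e)ᗮ → ℝ := fun z => ∫ g : OrthGroup E, ⟪g.1 e, v⟫ ^ (2 * m) * D (g.1 (z : E)) ∂ν
  let A : ℝ := ∫ w in closedBall (0 : (ℝ ∙ e)ᗮ) 1, ‖w‖ ^ (2 * m) ∂perpMeasure e
  have hJ : ∫ z in closedBall (0 : (ℝ ∙ e)ᗮ) R, J z ∂perpMeasure e = 0 := by
    rw [integral_integral_swap]
    · refine (integral_congr_ae (Filter.Eventually.of_forall fun g => ?_)).trans
        (integral_zero _ _)
      change ∫ z in closedBall (0 : (ℝ ∙ e)ᗮ) R, _ ∂perpMeasure e = 0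
      rw [integral_const_mul, hzero, mul_zero]
    · refine integrable_restrict_prod_of_bounded (C := 1) isClosed_closedBall.measurableSet
        (hfin R) ?_ fun z _ g => ?_
      · exact ((((continuous_inner_orbit e v).comp continuous_snd).pow _).measurable).mul
          (measurable_comp_apply hD e)
      · rw [norm_mul, norm_pow, Real.norm_eq_abs]
        exact mul_le_one₀ (pow_le_one₀ (abs_nonneg _) (abs_inner_orbit_le_one he hv g))
          (norm_nonneg _) (hD1 _)
  have hAJ : ∀ z : (ℝ ∙ e)ᗮ, A * J z =
      ∫ g : OrthGroup E, C * ((1 - ⟪g.1 e, v⟫ ^ 2) ^ m * D (‖z‖ • g.1 e)) ∂ν := by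
    intro z
    have h1 : A * J z = ∫ w in closedBall (0 : (ℝ ∙ e)ᗮ) 1, ∫ g : OrthGroup E,
        ⟪g.1 (w : E), v⟫ ^ (2 * m) * D (‖z‖ • g.1 e) ∂ν ∂perpMeasure e := by
      rw [← integral_mul_const]
      simp_rw [← norm_pow_mul_integral_orbit_eq he v m D z]
      rfl
    rw [h1, integral_integral_swap]
    · refine integral_congr_ae (Filter.Eventually.of_forall fun g => ?_)
      change ∫ w in closedBall (0 : (ℝ ∙ e)ᗮ) 1, _ ∂perpMeasure e = _
      rw [integral_mul_const, integral_ball_inner_apply_pow hv he hC, mul_assoc]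
    · refine integrable_restrict_prod_of_bounded (C := 1) isClosed_closedBall.measurableSet
        (hfin 1) ?_ fun w hw g => ?_
      · refine ((continuous_inner_apply e v).pow _).measurable.mul ?_
        exact (hD.comp (((OrthGroup.continuous_apply_const e).const_smul ‖z‖).measurable)).comp
          measurable_snd
      · rw [norm_mul, norm_pow]
        refine mul_le_one₀ (pow_le_one₀ (norm_nonneg _) ?_) (norm_nonneg _) (hD1 _)
        have h2 := abs_real_inner_le_norm (g.1 (w : E)) v
        rw [g.norm_apply, hv, mul_one] at h2
        exact h2.trans (mem_closedBall_zero_iff.mp hw)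
  have hswap : ∫ z in closedBall (0 : (ℝ ∙ e)ᗮ) R, A * J z ∂perpMeasure e =
      ∫ g : OrthGroup E, C * ((1 - ⟪g.1 e, v⟫ ^ 2) ^ m *
        ∫ z in closedBall (0 : (ℝ ∙ e)ᗮ) R, D (‖z‖ • g.1 e) ∂perpMeasure e) ∂ν := by
    simp_rw [hAJ]
    rw [integral_integral_swap]
    · refine integral_congr_ae (Filter.Eventually.of_forall fun g => ?_)
      change ∫ z in closedBall (0 : (ℝ ∙ e)ᗮ) R, _ ∂perpMeasure e = _
      rw [integral_const_mul, integral_const_mul]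
    · refine integrable_restrict_prod_of_bounded (C := C) isClosed_closedBall.measurableSet
        (hfin R) ?_ fun z _ g => ?_
      · refine Measurable.const_mul ?_ C
        exact (((continuous_const.sub (((continuous_inner_orbit e v).comp
          continuous_snd).pow 2)).pow m).measurable).mul (measurable_comp_orbit hD e)
      · rw [norm_mul, norm_mul, norm_pow, Real.norm_of_nonneg hCpos.le,
          Real.norm_of_nonneg (sub_nonneg.mpr (hsq g))]
        refine mul_le_of_le_one_right hCpos.le (mul_le_one₀ (pow_le_one₀ ?_ ?_)
          (norm_nonneg _) (hD1 _))
        · exact sub_nonneg.mpr (hsq g)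
        · linarith [sq_nonneg ⟪g.1 e, v⟫]
  rw [integral_const_mul, hJ, mul_zero, integral_const_mul] at hswap
  exact (mul_eq_zero.mp hswap.symm).resolve_left hCpos.ne'

lemma integrable_radial [IsFiniteMeasure ν] {e : E} {D : E → ℝ} (hD : Measurable D)
    (hD1 : ∀ x, ‖D x‖ ≤ 1) (R : ℝ) :
    Integrable (fun g : OrthGroup E =>
      ∫ z in closedBall (0 : (ℝ ∙ e)ᗮ) R, D (‖z‖ • g.1 e) ∂perpMeasure e) ν := by
  refine Integrable.integral_prod_right (f := Function.uncurry
    fun (z : (ℝ ∙ e)ᗮ) (g : OrthGroup E) => D (‖z‖ • g.1 e)) ?_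
  exact integrable_restrict_prod_of_bounded (C := 1) isClosed_closedBall.measurableSet
    measure_closedBall_lt_top.ne (measurable_comp_orbit hD e) fun _ _ _ => hD1 _

end Funk

section Ball

variable {E : Type*} [NormedAddCommGroup E] [InnerProductSpace ℝ E]

lemma norm_sub_lt_of_inner_gt {u v : E} (hu : ‖u‖ = 1) (hv : ‖v‖ = 1) {t ε : ℝ}
    (ht : 0 < t) (hε : 0 < ε) (h : 1 - ε ^ 2 / (2 * t ^ 2) < ⟪u, v⟫) : ‖t • u - t • v‖ < ε := by
  have h1 : ‖t • u - t • v‖ ^ 2 = t ^ 2 * (2 - 2 * ⟪u, v⟫) := by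
    rw [← smul_sub, norm_smul, mul_pow, Real.norm_eq_abs, sq_abs, norm_sub_sq_real, hu, hv]
    ring
  have h2 : t ^ 2 * (2 - 2 * ⟪u, v⟫) < ε ^ 2 := by
    have h3 : 1 - ⟪u, v⟫ < ε ^ 2 / (2 * t ^ 2) := by linarith
    rw [lt_div_iff₀ (by positivity)] at h3
    linarith
  exact lt_of_pow_lt_pow_left₀ 2 hε.le (h1 ▸ h2)

/-- A symmetric convex body that sticks out of the ball of radius `r` contains, for some `t > r`,
all vectors of length `t` whose direction is close to a fixed axis. -/
lemma exists_double_cap_subset {K : Set E} (hconv : Convex ℝ K) (h0 : (0 : E) ∈ interior K)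
    (hsym : K = -K) {r : ℝ} (hr : 0 < r) {x : E} (hx : x ∈ K) (hxr : r < ‖x‖) :
    ∃ v : E, ‖v‖ = 1 ∧ ∃ t η : ℝ, r < t ∧ t < ‖x‖ ∧ 0 ≤ η ∧ η < 1 ∧
      ∀ u : E, ‖u‖ = 1 → η < |⟪u, v⟫| → t • u ∈ K := by
  obtain ⟨t, hrt, htx⟩ := exists_between hxr
  have ht : 0 < t := hr.trans hrt
  have hx0 : 0 < ‖x‖ := hr.trans hxr
  let v : E := ‖x‖⁻¹ • x
  have hv : ‖v‖ = 1 := norm_smul_inv_norm (𝕜 := ℝ) (norm_pos_iff.mp hx0)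
  have htv : t • v ∈ interior K := by
    have htx' : t * ‖x‖⁻¹ < 1 := by
      rw [← div_eq_mul_inv]
      exact (div_lt_one hx0).mpr htx
    have h := hconv.combo_interior_self_mem_interior h0 hx (a := 1 - t * ‖x‖⁻¹)
      (b := t * ‖x‖⁻¹) (by linarith) (by positivity) (by ring)
    rwa [smul_zero, zero_add, mul_smul] at h
  obtain ⟨ε, hε, hball⟩ := Metric.isOpen_iff.mp isOpen_interior _ htv
  have hcap : ∀ u : E, ‖u‖ = 1 → 1 - ε ^ 2 / (2 * t ^ 2) < ⟪u, v⟫ → t • u ∈ K := by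
    intro u hu huv
    refine interior_subset (hball ?_)
    rw [mem_ball, dist_eq_norm]
    exact norm_sub_lt_of_inner_gt hu hv ht hε huv
  have hpos : 0 < ε ^ 2 / (2 * t ^ 2) := by positivity
  refine ⟨v, hv, t, max 0 (1 - ε ^ 2 / (2 * t ^ 2)), hrt, htx, le_max_left _ _,
    max_lt one_pos (by linarith), fun u hu huv => ?_⟩
  have huv' := (le_max_right _ _).trans_lt huv
  rcases le_total 0 ⟪u, v⟫ with hs | hs
  · rw [abs_of_nonneg hs] at huv'
    exact hcap u hu huv'
  · rw [abs_of_nonpos hs, ← inner_neg_left] at huv'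
    have h := hcap (-u) (by rw [norm_neg, hu]) huv'
    rw [smul_neg] at h
    rw [hsym]
    exact h

variable [FiniteDimensional ℝ E] [MeasurableSpace E] [BorelSpace E]

lemma measure_annulus_pos {V : Type*} [NormedAddCommGroup V] [NormedSpace ℝ V] [Nontrivial V]
    [MeasurableSpace V] (μ : Measure V) [μ.IsOpenPosMeasure] {r t : ℝ} (hr : 0 < r)
    (hrt : r < t) : 0 < μ (closedBall 0 t \ closedBall 0 r) := by
  obtain ⟨s, hrs, hst⟩ := exists_between hrt
  obtain ⟨w, hw⟩ := exists_norm_eq V (hr.trans hrs).le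
  refine ((isOpen_ball (x := (0 : V)) (ε := t)).sdiff isClosed_closedBall |>.measure_pos μ
    ⟨w, ?_, ?_⟩).trans_le (measure_mono (sdiff_subset_sdiff_left ball_subset_closedBall))
  · rw [mem_ball_zero_iff, hw]
    exact hst
  · rw [mem_closedBall_zero_iff, hw]
    exact hrs.not_ge

/-- A symmetric convex body all of whose central sections have the measure of the sections of a
ball is contained in that ball. -/
lemma subset_closedBall_of_measure_rotSection_eq {K : Set E} (hconv : Convex ℝ K)
    (hcomp : IsCompact K) (h0 : (0 : E) ∈ interior K) (hsym : K = -K) {r : ℝ} (hr : 0 < r)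
    {e : E} (he : ‖e‖ = 1) [Nontrivial (ℝ ∙ e)ᗮ]
    (h : ∀ g : OrthGroup E, perpMeasure e (rotSection K e g) = perpMeasure e (closedBall 0 r)) :
    K ⊆ closedBall 0 r := by
  intro x hx
  rw [mem_closedBall_zero_iff]
  by_contra! hxr
  obtain ⟨v, hv, t, η, hrt, htx, hη0, hη1, hcap⟩ :=
    exists_double_cap_subset hconv h0 hsym hr hx hxr
  obtain ⟨R, hR⟩ := hcomp.isBounded.subset_closedBall 0
  have hxR : ‖x‖ ≤ R := mem_closedBall_zero_iff.mp (hR hx)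
  have hK : MeasurableSet K := hcomp.isClosed.measurableSet
  have hB : MeasurableSet (closedBall (0 : E) r) := isClosed_closedBall.measurableSet
  let D : E → ℝ := fun y => K.indicator (fun _ => 1) y - (closedBall 0 r).indicator (fun _ => 1) y
  have hD : Measurable D :=
    (measurable_const.indicator hK).sub (measurable_const.indicator hB)
  have hD1 : ∀ y, ‖D y‖ ≤ 1 := by
    intro y
    by_cases hyK : y ∈ K <;> by_cases hyB : y ∈ closedBall (0 : E) r <;>
      simp only [D, indicator_of_mem, indicator_of_notMem, hyK, hyB, not_false_eq_true] <;>
      norm_num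
  have hfin : ∀ ρ : ℝ, perpMeasure e (closedBall 0 ρ) ≠ ∞ := fun ρ => measure_closedBall_lt_top.ne
  have hzero : ∀ g : OrthGroup E,
      ∫ z in closedBall (0 : (ℝ ∙ e)ᗮ) R, D (g.1 (z : E)) ∂perpMeasure e = 0 := by
    intro g
    have hset : ∀ L : Set E, IsClosed L → L ⊆ closedBall 0 R →
        IntegrableOn (fun z : (ℝ ∙ e)ᗮ => L.indicator (fun _ => (1 : ℝ)) (g.1 (z : E)))
          (closedBall 0 R) (perpMeasure e) ∧
        ∫ z in closedBall (0 : (ℝ ∙ e)ᗮ) R, L.indicator (fun _ => (1 : ℝ)) (g.1 (z : E))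
          ∂perpMeasure e = (perpMeasure e).real (rotSection L e g) := by
      intro L hL hLR
      have hm : MeasurableSet (rotSection L e g) := (isClosed_rotSection hL e g).measurableSet
      have hind : (fun z : (ℝ ∙ e)ᗮ => L.indicator (fun _ => (1 : ℝ)) (g.1 (z : E))) =
          (rotSection L e g).indicator fun _ => (1 : ℝ) := rfl
      have hsub : rotSection L e g ⊆ closedBall 0 R := by
        rw [← rotSection_closedBall e g R]
        exact preimage_mono hLR
      rw [hind]
      refine ⟨(integrableOn_const (hfin R)).indicator hm, ?_⟩
      rw [setIntegral_indicator hm, inter_eq_self_of_subset_right hsub, setIntegral_const,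
        smul_eq_mul, mul_one]
    have hrR : closedBall (0 : E) r ⊆ closedBall 0 R :=
      closedBall_subset_closedBall (hxr.le.trans hxR)
    obtain ⟨hi1, hv1⟩ := hset K hcomp.isClosed hR
    obtain ⟨hi2, hv2⟩ := hset (closedBall 0 r) isClosed_closedBall hrR
    rw [integral_sub hi1 hi2, hv1, hv2, rotSection_closedBall, Measure.real, h g, Measure.real,
      sub_self]
  obtain ⟨ν, _, _, _⟩ := OrthGroup.exists_invariant_measure E
  let f : OrthGroup E → ℝ := fun g =>
    ∫ z in closedBall (0 : (ℝ ∙ e)ᗮ) R, D (‖z‖ • g.1 e) ∂perpMeasure e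
  let q : OrthGroup E → ℝ := fun g => ⟪g.1 e, v⟫ ^ 2
  have hqc : Continuous q := (continuous_inner_orbit e v).pow 2
  have hq0 : ∀ g, 0 ≤ q g := fun g => sq_nonneg _
  have hq1 : ∀ g, q g ≤ 1 := fun g =>
    (sq_le_one_iff_abs_le_one _).mpr (abs_inner_orbit_le_one he hv g)
  have hf : Integrable f ν := integrable_radial hD hD1 R
  have hmom : ∀ M : ℕ, ∫ g, q g ^ M * f g ∂ν = 0 := by
    refine integral_pow_mul_eq_zero_of_one_sub (fun m => ?_)
      (fun m => integral_radial_mul_one_sub_sq_pow_eq_zero he hv hD hD1 hzero m)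
    refine hf.bdd_mul (c := 1) ((continuous_const.sub hqc).pow m).aestronglyMeasurable
      (Filter.Eventually.of_forall fun g => ?_)
    rw [norm_pow, Real.norm_of_nonneg (sub_nonneg.mpr (hq1 g))]
    exact pow_le_one₀ (sub_nonneg.mpr (hq1 g)) (by linarith [hq0 g])
  have hDint : ∀ g : OrthGroup E, IntegrableOn (fun z : (ℝ ∙ e)ᗮ => D (‖z‖ • g.1 e))
      (closedBall 0 R) (perpMeasure e) := by
    intro g
    refine Measure.integrableOn_of_bounded (M := 1) (hfin R) ?_
      (Filter.Eventually.of_forall fun z => hD1 _)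
    exact (hD.comp (Continuous.measurable (by fun_prop))).aestronglyMeasurable
  have hfc : ∀ g, -(perpMeasure e).real (closedBall 0 R) ≤ f g := by
    intro g
    have h1 := setIntegral_mono (integrableOn_const (C := (-1 : ℝ)) (hfin R)) (hDint g)
      fun z => (abs_le.mp (hD1 _)).1
    rwa [setIntegral_const, smul_eq_mul, mul_neg_one] at h1
  let S : Set (ℝ ∙ e)ᗮ := closedBall 0 t \ closedBall 0 r
  have hS : MeasurableSet S :=
    isClosed_closedBall.measurableSet.diff isClosed_closedBall.measurableSet
  have hSR : S ⊆ closedBall 0 R :=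
    sdiff_subset.trans (closedBall_subset_closedBall (htx.le.trans hxR))
  have hδ : 0 < (perpMeasure e).real S :=
    ENNReal.toReal_pos (measure_annulus_pos _ hr hrt).ne'
      ((measure_mono hSR).trans_lt measure_closedBall_lt_top).ne
  have hfδ : ∀ g, η ^ 2 < q g → (perpMeasure e).real S ≤ f g := by
    intro g hg
    have hηs : η < |⟪g.1 e, v⟫| := by
      rw [← abs_of_nonneg hη0]
      exact sq_lt_sq.mp hg
    have hge : ‖g.1 e‖ = 1 := by rw [g.norm_apply, he]
    have htK : t • g.1 e ∈ K := hcap _ hge hηs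
    have ht : 0 < t := hr.trans hrt
    have hmem : ∀ z : (ℝ ∙ e)ᗮ, ‖z‖ ≤ t → ‖z‖ • g.1 e ∈ K := by
      intro z hz
      have h1 := hconv.smul_mem_of_zero_mem (interior_subset h0) htK
        (t := ‖z‖ / t) ⟨by positivity, (div_le_one ht).mpr hz⟩
      rwa [smul_smul, div_mul_cancel₀ _ ht.ne'] at h1
    have hnorm : ∀ z : (ℝ ∙ e)ᗮ, ‖z‖ • g.1 e ∈ closedBall (0 : E) r ↔
        z ∈ closedBall (0 : (ℝ ∙ e)ᗮ) r := by
      intro z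
      rw [mem_closedBall_zero_iff, mem_closedBall_zero_iff, norm_smul, hge, mul_one, norm_norm]
    have hle : ∀ z : (ℝ ∙ e)ᗮ, S.indicator (fun _ => (1 : ℝ)) z ≤ D (‖z‖ • g.1 e) := by
      intro z
      by_cases hzr : z ∈ closedBall (0 : (ℝ ∙ e)ᗮ) r
      · have hzK := hmem z ((mem_closedBall_zero_iff.mp hzr).trans hrt.le)
        simp only [D, indicator_of_mem hzK, indicator_of_mem ((hnorm z).mpr hzr)]
        rw [indicator_of_notMem fun hzS : z ∈ S => hzS.2 hzr, sub_self]
      · simp only [D, indicator_of_notMem (mt (hnorm z).mp hzr), sub_zero]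
        by_cases hzt : z ∈ closedBall (0 : (ℝ ∙ e)ᗮ) t
        · rw [indicator_of_mem (hmem z (mem_closedBall_zero_iff.mp hzt))]
          exact indicator_le_self' (fun _ _ => zero_le_one) z
        · rw [indicator_of_notMem fun hzS : z ∈ S => hzt hzS.1]
          exact indicator_nonneg (fun _ _ => zero_le_one) _
    have h1 := setIntegral_mono ((integrableOn_const (C := (1 : ℝ)) (hfin R)).indicator hS)
      (hDint g) hle
    rwa [setIntegral_indicator hS, inter_eq_self_of_subset_right hSR, setIntegral_const,
      smul_eq_mul, mul_one] at h1
  have hη2 : η ^ 2 < 1 := by nlinarith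
  obtain ⟨b, hab, hb1⟩ := exists_between hη2
  have hpos : ν {g | b < q g} ≠ 0 := by
    refine (isOpen_lt continuous_const hqc).measure_ne_zero ν ?_
    obtain ⟨g, hg⟩ := OrthGroup.exists_apply_eq (he.trans hv.symm)
    refine ⟨g, ?_⟩
    change b < ⟪g.1 e, v⟫ ^ 2
    rw [hg, real_inner_self_eq_norm_sq, hv]
    simpa using hb1
  obtain ⟨M, hM⟩ := exists_integral_pow_mul_pos hqc.measurable hq0 hq1 hf (sq_nonneg η) hab
    measureReal_nonneg hδ hfc hfδ hpos
  exact hM.ne' (hmom M)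

lemma closedBall_subset_of_measure_rotSection_eq {K : Set E} (hcomp : IsCompact K) {r : ℝ}
    (hr : 0 < r) (hsub : K ⊆ closedBall 0 r) {e : E} [Nontrivial (ℝ ∙ e)ᗮ]
    (h : ∀ g : OrthGroup E, perpMeasure e (rotSection K e g) = perpMeasure e (closedBall 0 r)) :
    closedBall 0 r ⊆ K := by
  intro y hy
  by_contra hyK
  rw [← closure_ball _ hr.ne'] at hy
  obtain ⟨x, hxK, hxr⟩ := mem_closure_iff.mp hy Kᶜ hcomp.isClosed.isOpen_compl hyK
  obtain ⟨w, hw⟩ := exists_norm_eq (ℝ ∙ e)ᗮ (norm_nonneg x)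
  obtain ⟨g, hg⟩ := OrthGroup.exists_apply_eq (x := (w : E)) (x' := x) hw
  have hclosed := isClosed_rotSection hcomp.isClosed e g
  have hopen : IsOpen (ball 0 r \ rotSection K e g) := isOpen_ball.sdiff hclosed
  have hpos : 0 < perpMeasure e (ball 0 r \ rotSection K e g) := by
    refine hopen.measure_pos _ ⟨w, ?_, ?_⟩
    · rw [mem_ball_zero_iff, hw]
      exact mem_ball_zero_iff.mp hxr
    · rw [mem_rotSection, hg]
      exact hxK
  have hsub' : rotSection K e g ⊆ closedBall 0 r := by
    rw [← rotSection_closedBall e g r]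
    exact preimage_mono hsub
  have hdiff : perpMeasure e (closedBall 0 r \ rotSection K e g) = 0 := by
    rw [measure_sdiff hsub' hclosed.measurableSet.nullMeasurableSet
      (measure_rotSection_lt_top hcomp e g).ne, h g, tsub_self]
  exact hpos.ne' (measure_mono_null (sdiff_subset_sdiff_left ball_subset_closedBall) hdiff)

end Ball

/-- An origin-symmetric convex body in `ℝⁿ` whose central sections have the
same distribution function as those of a centered ball of radius `r` is that ball. -/
theorem stmt_7 (n : ℕ) (hn : 2 ≤ n) (K : Set (Euc n))
    (hK : IsConvexBody K) (hKsym : K = -K) (r : ℝ) (hr : 0 < r)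
    (h : ∀ t : ℝ, 0 ≤ t → Sdist n K t = Sdist n (closedBall (0 : Euc n) r) t) :
    K = closedBall (0 : Euc n) r := by
  obtain ⟨hconv, hcomp, hne⟩ := hK
  have h0 := zero_mem_interior_of_symmetric hconv hne hKsym
  have : Nontrivial (Euc n) := by
    refine Module.nontrivial_of_finrank_pos (R := ℝ) ?_
    rw [finrank_euclideanSpace_fin]
    omega
  obtain ⟨e, he⟩ := exists_norm_eq (Euc n) zero_le_one
  have : Nontrivial (ℝ ∙ e)ᗮ := by
    refine Module.nontrivial_of_finrank_pos (R := ℝ) ?_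
    have hdim := cast_finrank_orthogonal_unit he
    rw [finrank_euclideanSpace_fin] at hdim
    have hn' : (2 : ℝ) ≤ n := by exact_mod_cast hn
    have hpos : (0 : ℝ) < finrank ℝ (ℝ ∙ e)ᗮ := by linarith
    exact_mod_cast hpos
  have hsec := measure_rotSection_eq_of_Sdist_eq hconv hcomp h0 h he
  have hsub := subset_closedBall_of_measure_rotSection_eq hconv hcomp h0 hKsym hr he hsec
  exact hsub.antisymm (closedBall_subset_of_measure_rotSection_eq hcomp hr hsub hsec)
end
end
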